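/- arXiv:1104.0870 — 2 statements merged into one kernel-verified Lean document; each statement's English description precedes it below -/
import Mathlib

section
/- For every nonzero polynomial h ∈ ℙ(ℂ_N[z]), every point x in the fibre X(h) = Wr^{−1}(h) lies in a unique h-compatible Richardson variety X_{λ/μ}. -/
open Polynomial

noncomputable section

/-! ### The Grassmannian `X = Gr(d, ℂ_{n-1}[z])` and the Wronski map -/

/-- The Wronskian determinant of a `d`-tuple of polynomials. -/
def wronskDet (d : ℕ) (f : Fin d → Polynomial ℂ) : Polynomial ℂ :=
  Matrix.det (Matrix.of fun i j : Fin d =>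
    (fun p : Polynomial ℂ => Polynomial.derivative p)^[(j : ℕ)] (f i))

/-- `x` is a point of the Grassmannian `Gr(d, ℂ_{n-1}[z])`. -/
def IsGrPoint (n d : ℕ) (x : Submodule ℂ (Polynomial ℂ)) : Prop :=
  x ≤ Polynomial.degreeLT ℂ n ∧ Module.finrank ℂ x = d

/-- `x` lies in the fibre of the Wronski map over `h` (an element of the
projective space `ℙ(ℂ_N[z])`, i.e. the Wronskian of a basis of `x` is a nonzero
scalar multiple of `h`). -/
def InFibre (d : ℕ) (x : Submodule ℂ (Polynomial ℂ)) (h : Polynomial ℂ) : Prop :=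
  ∃ (f : Fin d → Polynomial ℂ) (c : ℂ), c ≠ 0 ∧ LinearIndependent ℂ f ∧
    Submodule.span ℂ (Set.range f) = x ∧ wronskDet d f = c • h

/-- The linear substitution `f(z) ↦ f(c·z)` on polynomials. -/
def rotMap (c : ℂ) : Polynomial ℂ →ₗ[ℂ] Polynomial ℂ :=
  (Polynomial.aeval (Polynomial.C c * Polynomial.X) :
    Polynomial ℂ →ₐ[ℂ] Polynomial ℂ).toLinearMap

/-- `x` is fixed by the cyclic group `C_r ⊂ PGL₂(ℂ)` of classes of
`diag(e^{πij/r}, e^{-πij/r})`, `j = 0, …, r-1`; the induced (projective) action on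
`Gr(d, ℂ_{n-1}[z])` is via the substitutions `z ↦ e^{-2πij/r} z`. -/
def CrFixed (r : ℕ) (x : Submodule ℂ (Polynomial ℂ)) : Prop :=
  ∀ j : Fin r,
    Submodule.map
      (rotMap (Complex.exp (-(2 * (Real.pi : ℂ) * Complex.I * ((j : ℕ) : ℂ)) / (r : ℂ)))) x = x

/-- The linear map `f(z) ↦ z^{n-1} f(1/z)` on `ℂ_{n-1}[z]`,
realizing the reflection `(0 1; 1 0) ∈ PGL₂(ℂ)`. -/
def reflectMap (n : ℕ) : Polynomial ℂ →ₗ[ℂ] Polynomial ℂ :=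
  ∑ k ∈ Finset.range n,
    (Polynomial.lcoeff ℂ k).smulRight ((Polynomial.X : Polynomial ℂ) ^ (n - 1 - k))

/-- `x` is fixed by the dihedral group `D_r ⊂ PGL₂(ℂ)` generated by `C_r` and the
reflection `z ↦ 1/z`. -/
def DrFixed (n r : ℕ) (x : Submodule ℂ (Polynomial ℂ)) : Prop :=
  CrFixed r x ∧ Submodule.map (reflectMap n) x = x

/-! ### Partitions, Richardson varieties, compatibility -/

/-- A partition with at most `d` parts, each of size at most `w`
(recorded as a function `ℕ → ℕ` vanishing from index `d` on; part `i` (0-based)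
is the `(i+1)`-st part). -/
structure PartitionIn (d w : ℕ) where
  part : ℕ → ℕ
  antitone : ∀ ⦃i j : ℕ⦄, i ≤ j → part j ≤ part i
  le_w : ∀ i, part i ≤ w
  eq_zero : ∀ i, d ≤ i → part i = 0

/-- The size `|λ|` of a partition. -/
def PartitionIn.size {d w : ℕ} (lam : PartitionIn d w) : ℕ :=
  ∑ i ∈ Finset.range d, lam.part i

/-- Containment `μ ⊆ λ` of partitions. -/
def SubPartition {d w : ℕ} (mu lam : PartitionIn d w) : Prop :=
  ∀ i, mu.part i ≤ lam.part i

/-- The full rectangular partition `(w)^d`. -/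
def rectPart (d w : ℕ) : PartitionIn d w :=
  { part := fun i => if i < d then w else 0
    antitone := by
      intro i j hij
      by_cases hj : j < d
      · have hi : i < d := lt_of_le_of_lt hij hj
        simp [hi, hj]
      · simp [hj]
    le_w := by intro i; by_cases hi : i < d <;> simp [hi]
    eq_zero := by intro i hi; simp [Nat.not_lt.mpr hi] }

/-- The empty partition. -/
def zeroPart (d w : ℕ) : PartitionIn d w :=
  { part := fun _ => 0
    antitone := by intro i j _; exact le_rfl
    le_w := fun _ => Nat.zero_le _
    eq_zero := fun _ _ => rfl }

/-- The flag `F_i = z^{n-i} ℂ_{i-1}[z]` inside `ℂ_{n-1}[z]`. -/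
def Fflag (n i : ℕ) : Submodule ℂ (Polynomial ℂ) :=
  Polynomial.degreeLT ℂ n ⊓
    Submodule.restrictScalars ℂ (Ideal.span {(Polynomial.X : Polynomial ℂ) ^ (n - i)})

/-- The flag `F̃_i = ℂ_{i-1}[z]`. -/
def Ftilde (i : ℕ) : Submodule ℂ (Polynomial ℂ) := Polynomial.degreeLT ℂ i

/-- Membership in the Richardson variety `X_{λ/μ}`. -/
def InRichardson (n d : ℕ) (lam mu : PartitionIn d (n - d))
    (x : Submodule ℂ (Polynomial ℂ)) : Prop :=
  ∀ i : ℕ, i < d →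
    i + 1 ≤ Module.finrank ℂ ↥(x ⊓ Fflag n (n - d - mu.part i + (i + 1))) ∧
    i + 1 ≤ Module.finrank ℂ ↥(x ⊓ Ftilde (lam.part (d - 1 - i) + (i + 1)))

/-- The Richardson variety `X_{λ/μ}` is compatible with the polynomial `h`:
`μ ⊆ λ`, `|λ| = deg h` and `|μ| = mindeg h`. -/
def Compatible (n d : ℕ) (lam mu : PartitionIn d (n - d)) (h : Polynomial ℂ) : Prop :=
  SubPartition mu lam ∧ lam.size = h.natDegree ∧ mu.size = h.rootMultiplicity 0

/-! ### Ribbons and tableaux -/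

/-- Two boxes (row, column) are adjacent. -/
def BoxAdj (p q : ℕ × ℕ) : Prop :=
  (p.1 = q.1 ∧ (p.2 + 1 = q.2 ∨ q.2 + 1 = p.2)) ∨
  (p.2 = q.2 ∧ (p.1 + 1 = q.1 ∨ q.1 + 1 = p.1))

/-- A set of boxes is an `r`-ribbon: it has `r` boxes, is connected,
and contains no 2×2 square. -/
def IsRibbon (r : ℕ) (S : Set (ℕ × ℕ)) : Prop :=
  S.ncard = r ∧
  (∀ p ∈ S, ∀ q ∈ S, Relation.ReflTransGen (fun u v => u ∈ S ∧ v ∈ S ∧ BoxAdj u v) p q) ∧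
  ¬ ∃ i j : ℕ, (i, j) ∈ S ∧ (i + 1, j) ∈ S ∧ (i, j + 1) ∈ S ∧ (i + 1, j + 1) ∈ S

/-- The box `(i,j)` (0-based row and column) lies in the skew diagram `λ/μ`. -/
def InShape {d w : ℕ} (lam mu : PartitionIn d w) (i j : ℕ) : Prop :=
  i < d ∧ mu.part i ≤ j ∧ j < lam.part i

/-- `E` is a standard `r`-ribbon tableau of skew shape `λ/μ` with entries `1, …, ℓ`
(recorded as a function on boxes, normalized to `0` off the shape). -/
def IsSRT {d w : ℕ} (r ℓ : ℕ) (lam mu : PartitionIn d w) (E : ℕ → ℕ → ℕ) : Prop :=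
  (∀ i j, ¬ InShape lam mu i j → E i j = 0) ∧
  (∀ i j, InShape lam mu i j → 1 ≤ E i j ∧ E i j ≤ ℓ) ∧
  (∀ i j j', InShape lam mu i j → InShape lam mu i j' → j ≤ j' → E i j ≤ E i j') ∧
  (∀ i i' j, InShape lam mu i j → InShape lam mu i' j → i ≤ i' → E i j ≤ E i' j) ∧
  (∀ k, 1 ≤ k → k ≤ ℓ → IsRibbon r {p : ℕ × ℕ | InShape lam mu p.1 p.2 ∧ E p.1 p.2 = k})

/-- A tableau (with boxes inside the `d × w` rectangle and largest entry `m`) is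
rotationally invariant: it is fixed by rotating `180°` inside the rectangle and
replacing each entry `k` by `m + 1 - k`. -/
def RotInvariant {d w : ℕ} (m : ℕ) (lam mu : PartitionIn d w) (E : ℕ → ℕ → ℕ) : Prop :=
  ∀ i j, InShape lam mu i j →
    InShape lam mu (d - 1 - i) (w - 1 - j) ∧
    E (d - 1 - i) (w - 1 - j) = m + 1 - E i j

/-- For `ℓ` even: a tableau of shape `λ/μ` with entries `1, …, ℓ-1`, in which the
boxes with entry `k ≠ ℓ/2` form `r`-ribbons and the boxes with entry `ℓ/2`
form a `2r`-ribbon. -/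
def IsHatSRT {d w : ℕ} (r ℓ : ℕ) (lam mu : PartitionIn d w) (E : ℕ → ℕ → ℕ) : Prop :=
  (∀ i j, ¬ InShape lam mu i j → E i j = 0) ∧
  (∀ i j, InShape lam mu i j → 1 ≤ E i j ∧ E i j ≤ ℓ - 1) ∧
  (∀ i j j', InShape lam mu i j → InShape lam mu i j' → j ≤ j' → E i j ≤ E i j') ∧
  (∀ i i' j, InShape lam mu i j → InShape lam mu i' j → i ≤ i' → E i j ≤ E i' j) ∧
  (∀ k, 1 ≤ k → k ≤ ℓ - 1 → k ≠ ℓ / 2 →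
    IsRibbon r {p : ℕ × ℕ | InShape lam mu p.1 p.2 ∧ E p.1 p.2 = k}) ∧
  IsRibbon (2 * r) {p : ℕ × ℕ | InShape lam mu p.1 p.2 ∧ E p.1 p.2 = ℓ / 2}

/-! ### Rectangular standard Young tableaux, promotion and evacuation -/

/-- `E` is a standard Young tableau of rectangular shape `d × w`
(normalized to `0` outside the rectangle). -/
def IsSYT (d w : ℕ) (E : ℕ → ℕ → ℕ) : Prop :=
  (∀ i j, d ≤ i ∨ w ≤ j → E i j = 0) ∧
  (∀ i j, i < d → j < w → 1 ≤ E i j ∧ E i j ≤ d * w) ∧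
  (∀ i j, i < d → j + 1 < w → E i j < E i (j + 1)) ∧
  (∀ i j, i + 1 < d → j < w → E i j < E (i + 1) j) ∧
  (∀ m, 1 ≤ m → m ≤ d * w → ∃ i j, i < d ∧ j < w ∧ E i j = m)

/-- One step of the jeu de taquin slide of the empty box, restricted to the
subtableau of entries `≤ i₀`: the empty box swaps with the smaller of its east
and south neighbours (among entries `≤ i₀`), if any. -/
def slideStep (d w i₀ : ℕ) (E : ℕ → ℕ → ℕ) (p : ℕ × ℕ) : ℕ × ℕ :=
  if (p.1 + 1 < d ∧ E (p.1 + 1) p.2 ≤ i₀) ∧ (p.2 + 1 < w ∧ E p.1 (p.2 + 1) ≤ i₀) then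
    (if E (p.1 + 1) p.2 < E p.1 (p.2 + 1) then (p.1 + 1, p.2) else (p.1, p.2 + 1))
  else if p.1 + 1 < d ∧ E (p.1 + 1) p.2 ≤ i₀ then (p.1 + 1, p.2)
  else if p.2 + 1 < w ∧ E p.1 (p.2 + 1) ≤ i₀ then (p.1, p.2 + 1)
  else p

/-- The path of the empty box in the jeu de taquin slide, starting in the
northwest corner. -/
def slidePath (d w i₀ : ℕ) (E : ℕ → ℕ → ℕ) : ℕ → ℕ × ℕ
  | 0 => (0, 0)
  | k + 1 => slideStep d w i₀ E (slidePath d w i₀ E k)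

/-- Promotion restricted to the entries `1, …, i₀` (the operator `𝑗_{i₀}`):
delete the entry `1`, slide the empty box through the entries `≤ i₀`, decrement
those entries by one and place `i₀` in the final empty box. -/
def partialPromo (d w i₀ : ℕ) (E : ℕ → ℕ → ℕ) : ℕ → ℕ → ℕ := fun i j =>
  if d ≤ i ∨ w ≤ j then 0
  else if (i, j) = slidePath d w i₀ E i₀ then i₀
  else if slidePath d w i₀ E (i + j) = (i, j) then
    E (slidePath d w i₀ E (i + j + 1)).1 (slidePath d w i₀ E (i + j + 1)).2 - 1
  else if E i j ≤ i₀ then E i j - 1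
  else E i j

/-- Jeu de taquin promotion `𝑗` on fillings of the `d × w` rectangle. -/
def promo (d w : ℕ) (E : ℕ → ℕ → ℕ) : ℕ → ℕ → ℕ := partialPromo d w (d * w) E

/-- `evacAux d w i = 𝑗_1 ∘ 𝑗_2 ∘ ⋯ ∘ 𝑗_i`. -/
def evacAux (d w : ℕ) : ℕ → (ℕ → ℕ → ℕ) → (ℕ → ℕ → ℕ)
  | 0, E => E
  | i + 1, E => evacAux d w i (partialPromo d w (i + 1) E)

/-- Evacuation `𝑒 = 𝑗_1 ∘ 𝑗_2 ∘ ⋯ ∘ 𝑗_N` on fillings of the `d × w` rectangle. -/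
def evac (d w : ℕ) (E : ℕ → ℕ → ℕ) : ℕ → ℕ → ℕ := evacAux d w (d * w) E

/-- The `C_r`-fixed polynomial `z^m (z^r + h_1) ⋯ (z^r + h_ℓ)`. -/
def crPoly (r m ℓ : ℕ) (hs : Fin ℓ → ℂ) : Polynomial ℂ :=
  Polynomial.X ^ m * ∏ i : Fin ℓ, (Polynomial.X ^ r + Polynomial.C (hs i))

/-- The product `∏ (z^r + a_i)(z^r + a_i⁻¹)` of generic inverse pairs. -/
def pairsPoly (r t : ℕ) (a : Fin t → ℂ) : Polynomial ℂ :=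
  ∏ i : Fin t,
    ((Polynomial.X ^ r + Polynomial.C (a i)) * (Polynomial.X ^ r + Polynomial.C (a i)⁻¹))

/-- A `D_r`-fixed polynomial of type (1). -/
def type1poly (r m t : ℕ) (ε : ℂ) (a : Fin t → ℂ) : Polynomial ℂ :=
  Polynomial.X ^ m * (Polynomial.X ^ r + Polynomial.C ε) * pairsPoly r t a

/-- A `D_r`-fixed polynomial of type (2). -/
def type2poly (r m t : ℕ) (a : Fin t → ℂ) : Polynomial ℂ :=
  Polynomial.X ^ m * pairsPoly r t a

/-- A `D_r`-fixed polynomial of type (3). -/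
def type3poly (r m t : ℕ) (a : Fin t → ℂ) : Polynomial ℂ :=
  Polynomial.X ^ m * (Polynomial.X ^ r + 1) * (Polynomial.X ^ r - 1) * pairsPoly r t a

/-- `x` is an even-odd point: it has a basis each of whose members is an even or
an odd polynomial. -/
def IsEvenOddPoint (d : ℕ) (x : Submodule ℂ (Polynomial ℂ)) : Prop :=
  ∃ f : Fin d → Polynomial ℂ, LinearIndependent ℂ f ∧
    Submodule.span ℂ (Set.range f) = x ∧
    ∀ i, (f i).comp (-Polynomial.X) = f i ∨ (f i).comp (-Polynomial.X) = -(f i)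

/-- `x` is a real point: it has a basis of polynomials with real coefficients. -/
def IsRealPoint (d : ℕ) (x : Submodule ℂ (Polynomial ℂ)) : Prop :=
  ∃ f : Fin d → Polynomial ℂ, LinearIndependent ℂ f ∧
    Submodule.span ℂ (Set.range f) = x ∧
    ∀ i k, ((f i).coeff k).im = 0

/-- The Möbius action of a matrix on `ℂℙ¹ = ℂ ∪ {∞}` (modelled by `Option ℂ`,
with `none` playing the role of `∞`). -/
def mobP1 (M : Matrix (Fin 2) (Fin 2) ℂ) : Option ℂ → Option ℂ := fun p =>
  match p with
  | none => if M 1 0 = 0 then none else some (M 0 0 / M 1 0)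
  | some a =>
      if M 1 0 * a + M 1 1 = 0 then none
      else some ((M 0 0 * a + M 0 1) / (M 1 0 * a + M 1 1))

/-- The action of a matrix `φ` on `ℂ_{n-1}[z] `:
`(φf)(z) = (φ₂₁ z + φ₁₁)^{n-1} f((φ₂₂ z + φ₁₂)/(φ₂₁ z + φ₁₁))`. -/
def mobiusMap (n : ℕ) (M : Matrix (Fin 2) (Fin 2) ℂ) : Polynomial ℂ →ₗ[ℂ] Polynomial ℂ :=
  ∑ k ∈ Finset.range n, (Polynomial.lcoeff ℂ k).smulRight
    ((Polynomial.C (M 1 1) * Polynomial.X + Polynomial.C (M 0 1)) ^ k *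
     (Polynomial.C (M 1 0) * Polynomial.X + Polynomial.C (M 0 0)) ^ (n - 1 - k))

/-- The polynomial `∏_{a_i ≠ ∞} (z + a_i)` attached to a tuple of points of `ℂℙ¹`. -/
def rootsPoly (N : ℕ) (a : Fin N → Option ℂ) : Polynomial ℂ :=
  ∏ i : Fin N, (a i).elim 1 (fun c => Polynomial.X + Polynomial.C c)

/-- The eigenspace `M_k`: the span of the monomials `z^j`, `j < n`, `j ≡ k (mod r)`. -/
def eigSpace (n r : ℕ) (k : Fin r) : Submodule ℂ (Polynomial ℂ) :=
  Submodule.span ℂ {p : Polynomial ℂ | ∃ j : ℕ, j < n ∧ j % r = (k : ℕ) ∧ p = Polynomial.X ^ j}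

/-- The operator `c` on `ℂ_{n-1}[z]` with `c · z^k = ζ^{n-1-2k} z^k`, `ζ = e^{πi/r}`. -/
def cMap (n r : ℕ) : Polynomial ℂ →ₗ[ℂ] Polynomial ℂ :=
  (Complex.exp ((Real.pi : ℂ) * Complex.I / (r : ℂ))) ^ (n - 1) •
    (Polynomial.aeval
        (Polynomial.C (((Complex.exp ((Real.pi : ℂ) * Complex.I / (r : ℂ))) ^ 2)⁻¹) *
          Polynomial.X) :
      Polynomial ℂ →ₐ[ℂ] Polynomial ℂ).toLinearMap

/-- `μ` is obtained from `λ` by removing a single `r`-ribbon. -/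
def RibbonStep {d w : ℕ} (r : ℕ) (lam mu : PartitionIn d w) : Prop :=
  SubPartition mu lam ∧ IsRibbon r {p : ℕ × ℕ | InShape lam mu p.1 p.2}

/-- `λ` and `μ` have the same `r`-core: they are related by the equivalence
relation generated by removal of a single `r`-ribbon. -/
def RibbonEquiv {d w : ℕ} (r : ℕ) (lam mu : PartitionIn d w) : Prop :=
  Relation.EqvGen (fun a b => RibbonStep r a b) lam mu

/-- `κ` is an `r`-core: no `r`-ribbon can be removed from it. -/
def IsRCore {d w : ℕ} (r : ℕ) (kappa : PartitionIn d w) : Prop :=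
  ¬ ∃ mu : PartitionIn d w, RibbonStep r kappa mu

/-- The column set `J(λ) = {i - 1 + λ^{d+1-i} : 1 ≤ i ≤ d}` of the Plücker
coordinate `p_λ`, as a function of `i`. -/
def pluckerIndex {d w : ℕ} (lam : PartitionIn d w) (i : Fin d) : ℕ :=
  (i : ℕ) + lam.part (d - 1 - (i : ℕ))

/-- The Plücker coordinate `p_λ(x)` of `x` is nonzero (this does not depend on
the choice of basis of `x`). -/
def PluckerNonzero (d : ℕ) {w : ℕ} (lam : PartitionIn d w)
    (x : Submodule ℂ (Polynomial ℂ)) : Prop :=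
  ∃ f : Fin d → Polynomial ℂ, LinearIndependent ℂ f ∧
    Submodule.span ℂ (Set.range f) = x ∧
    Matrix.det (Matrix.of fun i i' : Fin d => (f i).coeff (pluckerIndex lam i')) ≠ 0

end

theorem aux_echelon {V : Type*} [AddCommGroup V] [Module ℂ V] (φ : ℕ → V →ₗ[ℂ] ℂ) :
    ∀ (d : ℕ) (W : Submodule ℂ V), Module.finrank ℂ W = d → FiniteDimensional ℂ W →
      (∀ v ∈ W, (∀ k, φ k v = 0) → v = 0) →
      ∃ (a : Fin d → ℕ) (g : Fin d → V), StrictMono a ∧ LinearIndependent ℂ g ∧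
        (∀ i, g i ∈ W) ∧ (∀ i, ∀ k < a i, φ k (g i) = 0) ∧ (∀ i, φ (a i) (g i) ≠ 0) ∧
        (∀ (i : Fin d) (t : ℕ) (A : Submodule ℂ V),
          (∀ v, v ∈ A ↔ v ∈ W ∧ ∀ k < t, φ k v = 0) →
          (d - (i : ℕ) ≤ Module.finrank ℂ A ↔ t ≤ a i)) := by
  intro d
  induction d with
  | zero =>
    intro W _ _ _
    exact ⟨Fin.elim0, Fin.elim0, fun i => i.elim0, linearIndependent_empty_type,
      fun i => i.elim0, fun i => i.elim0, fun i => i.elim0, fun i => i.elim0⟩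
  | succ d ih =>
    intro W hW hfin hinj
    classical
    have hex : ∃ k, ∃ v ∈ W, φ k v ≠ 0 := by
      by_contra hcon
      push Not at hcon
      have : W = ⊥ := by
        rw [Submodule.eq_bot_iff]
        intro v hv
        exact hinj v hv (fun k => hcon k v hv)
      rw [this] at hW
      simp at hW
    obtain ⟨v0, hv0, hv0'⟩ := Nat.find_spec hex
    have hmin : ∀ k < Nat.find hex, ∀ v ∈ W, φ k v = 0 := by
      intro k hk v hv
      have := Nat.find_min hex hk
      push Not at this
      exact this v hv
    generalize Nat.find hex = m at hv0' hmin
    have hW' : Module.finrank ℂ ↥(W ⊓ LinearMap.ker (φ m)) = d := by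
      have h1 := ((φ m).domRestrict W).finrank_range_add_finrank_ker
      have h2 : LinearMap.range ((φ m).domRestrict W) = ⊤ := by
        rw [LinearMap.range_eq_top]
        apply LinearMap.surjective
        intro h0
        exact hv0' (by simpa using LinearMap.congr_fun h0 ⟨v0, hv0⟩)
      have h3 : Submodule.map W.subtype (LinearMap.ker ((φ m).domRestrict W))
          = W ⊓ LinearMap.ker (φ m) := by
        ext v
        simp [Submodule.mem_map, and_comm]
      rw [← h3, Submodule.finrank_map_subtype_eq]
      rw [h2, finrank_top, Module.finrank_self, hW] at h1
      omega
    obtain ⟨a, g, ha, hg, hgW, hlow, hne, hdim⟩ := ih (W ⊓ LinearMap.ker (φ m)) hW'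
      inferInstance (fun v hv => hinj v hv.1)
    have hma : ∀ i, m < a i := by
      intro i
      by_contra hcon
      push Not at hcon
      rcases hcon.lt_or_eq with h | h
      · exact hne i (hmin _ h _ (hgW i).1)
      · exact hne i (h ▸ (hgW i).2)
    refine ⟨Fin.cons m a, Fin.cons v0 g, ?_, ?_, ?_, ?_, ?_, ?_⟩
    · intro i j hij
      induction i using Fin.cases with
      | zero =>
        induction j using Fin.cases with
        | zero => exact absurd hij (lt_irrefl _)
        | succ j => simpa using hma j
      | succ i =>
        induction j using Fin.cases with
        | zero => exact absurd hij (Fin.not_lt_zero _)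
        | succ j => simpa using ha (Fin.succ_lt_succ_iff.mp hij)
    · rw [linearIndependent_finCons]
      refine ⟨hg, fun hmem => hv0' ?_⟩
      have : Submodule.span ℂ (Set.range g) ≤ LinearMap.ker (φ m) := by
        rw [Submodule.span_le]
        rintro _ ⟨i, rfl⟩
        exact (hgW i).2
      exact this hmem
    · intro i
      refine Fin.cases ?_ (fun i => ?_) i
      · exact hv0
      · exact (hgW i).1
    · intro i
      refine Fin.cases ?_ (fun i => ?_) i
      · intro k hk; exact hmin k hk v0 hv0
      · exact hlow i
    · intro i
      refine Fin.cases ?_ (fun i => ?_) i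
      · exact hv0'
      · exact hne i
    · intro i t A hA
      have hcase1 : t ≤ m → A = W := by
        intro htm
        ext v
        rw [hA]
        exact ⟨fun h => h.1, fun h => ⟨h, fun k hk => hmin k (by omega) v h⟩⟩
      have hcase2 : m < t → ∀ v, v ∈ A ↔ v ∈ W ⊓ LinearMap.ker (φ m) ∧ ∀ k < t, φ k v = 0 := by
        intro htm v
        rw [hA]
        exact ⟨fun h => ⟨⟨h.1, h.2 m htm⟩, h.2⟩, fun h => ⟨h.1.1, h.2⟩⟩
      refine Fin.cases ?_ (fun i => ?_) i
      · simp only [Fin.val_zero, Fin.cons_zero]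
        constructor
        · intro h
          by_contra hcon
          push Not at hcon
          have hle : A ≤ W ⊓ LinearMap.ker (φ m) := fun v hv => ((hcase2 hcon v).1 hv).1
          have := Submodule.finrank_mono hle
          omega
        · intro h
          rw [hcase1 h]; omega
      · simp only [Fin.val_succ, Fin.cons_succ]
        by_cases htm : t ≤ m
        · rw [hcase1 htm]
          have := hma i
          constructor
          · intro; omega
          · intro; omega
        · push Not at htm
          rw [← hdim i t A (hcase2 htm)]
          have : d + 1 - (↑i + 1) = d - (i : ℕ) := by omega
          rw [this]

theorem aux_coeff_euler (p : Polynomial ℂ) (j m : ℕ) :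
    ((X : Polynomial ℂ) ^ j * (fun p : Polynomial ℂ => Polynomial.derivative p)^[j] p).coeff m
      = p.coeff m * (m.descFactorial j : ℂ) := by
  rw [coeff_X_pow_mul']
  split_ifs with hjm
  · have := coeff_iterate_derivative (k := j) p (m - j)
    rw [Nat.sub_add_cancel hjm, nsmul_eq_mul, mul_comm] at this
    exact this
  · rw [Nat.descFactorial_eq_zero_iff_lt.mpr (by omega)]
    simp

theorem aux_det_euler (d : ℕ) (f : Fin d → Polynomial ℂ) :
    Matrix.det (Matrix.of fun i j : Fin d => (X : Polynomial ℂ) ^ (j : ℕ) *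
      (fun p : Polynomial ℂ => Polynomial.derivative p)^[(j : ℕ)] (f i))
      = X ^ (∑ j : Fin d, (j : ℕ)) * wronskDet d f := by
  rw [← Finset.prod_pow_eq_pow_sum, wronskDet]
  exact Matrix.det_mul_row (fun j : Fin d => (X : Polynomial ℂ) ^ (j : ℕ)) _

theorem aux_det_desc (d : ℕ) (a : Fin d → ℕ) (ha : Function.Injective a) (c : Fin d → ℂ)
    (hc : ∀ i, c i ≠ 0) :
    Matrix.det (Matrix.of fun i j : Fin d => c i * ((a i).descFactorial (j : ℕ) : ℂ)) ≠ 0 := by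
  have h1 := Matrix.det_mul_column c
    (Matrix.of fun i j : Fin d => ((a i).descFactorial (j : ℕ) : ℂ))
  have h2 := Matrix.det_eval_matrixOfPolynomials_eq_det_vandermonde (fun i => (a i : ℂ))
    (fun j : Fin d => descPochhammer ℂ (j : ℕ)) (fun j => descPochhammer_natDegree ℂ _)
    (fun j => monic_descPochhammer ℂ _)
  simp only [descPochhammer_eval_eq_descFactorial] at h2
  simp only [Matrix.of_apply] at h1
  rw [h1, ← h2]
  refine mul_ne_zero (Finset.prod_ne_zero_iff.mpr fun i _ => hc i) ?_
  rw [Matrix.det_vandermonde_ne_zero_iff]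
  intro i j hij
  exact ha (Nat.cast_injective hij)

theorem aux_coeff_prod {ι : Type*} (s : Finset ι) (f : ι → Polynomial ℂ) (a : ι → ℕ)
    (h : ∀ i ∈ s, (f i).natDegree ≤ a i) :
    (∏ i ∈ s, f i).natDegree ≤ ∑ i ∈ s, a i ∧
    (∏ i ∈ s, f i).coeff (∑ i ∈ s, a i) = ∏ i ∈ s, (f i).coeff (a i) := by
  classical
  induction s using Finset.induction_on with
  | empty => simp
  | insert i s his ih =>
    rw [Finset.prod_insert his, Finset.prod_insert his, Finset.sum_insert his]
    have h1 := ih (fun j hj => h j (Finset.mem_insert_of_mem hj))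
    have h2 := h i (Finset.mem_insert_self _ _)
    exact ⟨natDegree_mul_le_of_le h2 h1.1,
      by rw [coeff_mul_add_eq_of_natDegree_le h2 h1.1, h1.2]⟩

theorem aux_det_coeff (d : ℕ) (M : Matrix (Fin d) (Fin d) (Polynomial ℂ)) (a : Fin d → ℕ)
    (h : ∀ i j, (M i j).natDegree ≤ a i) :
    M.det.natDegree ≤ ∑ i, a i ∧
    M.det.coeff (∑ i, a i) = Matrix.det (Matrix.of fun i j => (M i j).coeff (a i)) := by
  have key := fun σ : Equiv.Perm (Fin d) =>
    aux_coeff_prod Finset.univ (fun i => M i (σ i)) a (fun i _ => h i (σ i))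
  rw [← Matrix.det_transpose, ← Matrix.det_transpose (Matrix.of _)]
  rw [Matrix.det_apply, Matrix.det_apply]
  simp only [Matrix.transpose_apply, Matrix.of_apply]
  constructor
  · refine natDegree_sum_le_of_forall_le _ _ fun σ _ => ?_
    exact (natDegree_smul_le _ _).trans (key σ).1
  · rw [finsetSum_coeff]
    refine Finset.sum_congr rfl fun σ _ => ?_
    rw [← (key σ).2]
    rcases Int.units_eq_one_or (Equiv.Perm.sign σ) with hs | hs <;> simp [hs]

theorem aux_natDegree_wronsk (d : ℕ) (g : Fin d → Polynomial ℂ) (a : Fin d → ℕ)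
    (ha : Function.Injective a) (hdeg : ∀ i, (g i).natDegree ≤ a i)
    (hne : ∀ i, (g i).coeff (a i) ≠ 0) :
    wronskDet d g ≠ 0 ∧ (wronskDet d g).natDegree + ∑ j : Fin d, (j : ℕ) = ∑ i, a i := by
  have h1 := aux_det_coeff d (Matrix.of fun i j : Fin d => (X : Polynomial ℂ) ^ (j : ℕ) *
      (fun p : Polynomial ℂ => Polynomial.derivative p)^[(j : ℕ)] (g i)) a (by
    intro i j
    rw [natDegree_le_iff_coeff_eq_zero]
    intro N hN
    rw [Matrix.of_apply, aux_coeff_euler, coeff_eq_zero_of_natDegree_lt ((hdeg i).trans_lt hN),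
      zero_mul])
  rw [aux_det_euler] at h1
  simp only [Matrix.of_apply, aux_coeff_euler] at h1
  have h2 := aux_det_desc d a ha (fun i => (g i).coeff (a i)) hne
  rw [← h1.2] at h2
  have h3 := natDegree_eq_of_le_of_coeff_ne_zero h1.1 h2
  have h4 : wronskDet d g ≠ 0 := by
    intro h0
    rw [h0] at h2
    simp at h2
  refine ⟨h4, ?_⟩
  rw [natDegree_mul (pow_ne_zero _ X_ne_zero) h4, natDegree_X_pow] at h3
  omega

theorem aux_rootMult_wronsk (d : ℕ) (g : Fin d → Polynomial ℂ) (a : Fin d → ℕ)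
    (ha : Function.Injective a) (hlow : ∀ i, ∀ k < a i, (g i).coeff k = 0)
    (hne : ∀ i, (g i).coeff (a i) ≠ 0) :
    (wronskDet d g).rootMultiplicity 0 + ∑ j : Fin d, (j : ℕ) = ∑ i, a i := by
  have hdvd : ∀ i j : Fin d, ∃ q : Polynomial ℂ, (X : Polynomial ℂ) ^ (j : ℕ) *
      (fun p : Polynomial ℂ => Polynomial.derivative p)^[(j : ℕ)] (g i) = X ^ (a i) * q := by
    intro i j
    have : (X : Polynomial ℂ) ^ (a i) ∣ (X : Polynomial ℂ) ^ (j : ℕ) *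
      (fun p : Polynomial ℂ => Polynomial.derivative p)^[(j : ℕ)] (g i) := by
      rw [X_pow_dvd_iff]
      intro k hk
      rw [aux_coeff_euler, hlow i k hk, zero_mul]
    exact this
  choose q hq using hdvd
  have hq0 : ∀ i j, (q i j).coeff 0 = (g i).coeff (a i) * ((a i).descFactorial (j : ℕ) : ℂ) := by
    intro i j
    rw [← aux_coeff_euler, hq, coeff_X_pow_mul']
    simp
  have h1 := aux_det_euler d g
  simp only [hq] at h1
  have h2 := Matrix.det_mul_column (fun i => (X : Polynomial ℂ) ^ (a i)) (Matrix.of q)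
  simp only [Matrix.of_apply] at h2
  rw [h2, Finset.prod_pow_eq_pow_sum] at h1
  have h3 : (Matrix.of q).det.coeff 0 ≠ 0 := by
    have h4 := aux_det_desc d a ha (fun i => (g i).coeff (a i)) hne
    have h5 : (Matrix.of q).det.coeff 0 = ((Matrix.of q).map (constantCoeff (R := ℂ))).det := by
      rw [← RingHom.mapMatrix_apply, ← RingHom.map_det]
      rfl
    rw [h5]
    convert h4 using 2
    ext i j
    simpa using hq0 i j
  have hQ : (Matrix.of q).det ≠ 0 := by
    intro h0; rw [h0] at h3; simp at h3
  have hW : wronskDet d g ≠ 0 := by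
    intro h0
    rw [h0, mul_zero] at h1
    exact mul_ne_zero (pow_ne_zero _ X_ne_zero) hQ h1
  have h6 := congrArg natTrailingDegree h1
  rw [natTrailingDegree_mul (pow_ne_zero _ X_ne_zero) hQ,
    natTrailingDegree_mul (pow_ne_zero _ X_ne_zero) hW,
    natTrailingDegree_X_pow, natTrailingDegree_X_pow,
    natTrailingDegree_eq_zero.mpr (Or.inr h3)] at h6
  rw [rootMultiplicity_eq_natTrailingDegree']
  omega

theorem aux_wronsk_change (d : ℕ) (f g : Fin d → Polynomial ℂ)
    (hf : ∀ i, f i ∈ Submodule.span ℂ (Set.range g)) :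
    ∃ c : ℂ, wronskDet d f = C c * wronskDet d g := by
  have : ∀ i, ∃ P : Fin d → ℂ, ∑ j, P j • g j = f i := fun i =>
    (Submodule.mem_span_range_iff_exists_fun ℂ).mp (hf i)
  choose P hP using this
  refine ⟨(Matrix.of P).det, ?_⟩
  rw [RingHom.map_det, wronskDet, wronskDet, ← Matrix.det_mul]
  congr 1
  ext1 i j
  rw [Matrix.mul_apply]
  simp only [Matrix.of_apply, RingHom.mapMatrix_apply, Matrix.map_apply]
  rw [← hP i]
  have h1 := iterate_derivative_sum (j : ℕ) Finset.univ (fun k => P i k • g k)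
  refine h1.trans (Finset.sum_congr rfl fun k _ => ?_)
  rw [iterate_derivative_smul, smul_eq_C_mul]

theorem aux_wronsk_h (d : ℕ) (f g : Fin d → Polynomial ℂ) (h : Polynomial ℂ) (c : ℂ)
    (hc : c ≠ 0) (hne : h ≠ 0) (hw : wronskDet d f = c • h)
    (hf : ∀ i, f i ∈ Submodule.span ℂ (Set.range g)) :
    h.natDegree = (wronskDet d g).natDegree ∧
      h.rootMultiplicity 0 = (wronskDet d g).rootMultiplicity 0 := by
  obtain ⟨e, he⟩ := aux_wronsk_change d f g hf
  rw [hw, smul_eq_C_mul] at he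
  have hCc : (C c : Polynomial ℂ) ≠ 0 := C_ne_zero.mpr hc
  have h0 : (C e : Polynomial ℂ) * wronskDet d g ≠ 0 := he ▸ mul_ne_zero hCc hne
  have he0 := left_ne_zero_of_mul h0
  have hg0 := right_ne_zero_of_mul h0
  constructor
  · have := congrArg natDegree he
    rwa [natDegree_C_mul hc, natDegree_C_mul (C_ne_zero.mp he0)] at this
  · rw [rootMultiplicity_eq_natTrailingDegree', rootMultiplicity_eq_natTrailingDegree']
    have := congrArg natTrailingDegree he
    rwa [natTrailingDegree_mul hCc hne, natTrailingDegree_mul he0 hg0, natTrailingDegree_C,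
      natTrailingDegree_C, zero_add, zero_add] at this

theorem aux_span_eq {d : ℕ} {x : Submodule ℂ (Polynomial ℂ)} [FiniteDimensional ℂ x]
    (hx : Module.finrank ℂ x = d) (g : Fin d → Polynomial ℂ) (hg : LinearIndependent ℂ g)
    (hgx : ∀ i, g i ∈ x) : Submodule.span ℂ (Set.range g) = x := by
  apply Submodule.eq_of_le_of_finrank_le
  · rw [Submodule.span_le]
    rintro _ ⟨i, rfl⟩
    exact hgx i
  · rw [finrank_span_eq_card hg, hx, Fintype.card_fin]

theorem aux_low (n d : ℕ) (x : Submodule ℂ (Polynomial ℂ)) (hx : IsGrPoint n d x)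
    [FiniteDimensional ℂ x] :
    ∃ (a : Fin d → ℕ) (g : Fin d → Polynomial ℂ), StrictMono a ∧ (∀ i, a i < n) ∧
      Submodule.span ℂ (Set.range g) = x ∧ (∀ i, ∀ k < a i, (g i).coeff k = 0) ∧
      (∀ i, (g i).coeff (a i) ≠ 0) ∧
      (∀ (i : Fin d) (m : ℕ), d - (i : ℕ) ≤ Module.finrank ℂ ↥(x ⊓ Fflag n m) ↔
        n - m ≤ a i) := by
  obtain ⟨a, g, ha, hg, hgx, hlow, hne, hdim⟩ := aux_echelon (fun k => lcoeff ℂ k) d x hx.2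
    inferInstance (fun v _ hv => by ext k; simpa using hv k)
  refine ⟨a, g, ha, ?_, aux_span_eq hx.2 g hg hgx, hlow, hne, ?_⟩
  · intro i
    by_contra hcon
    push Not at hcon
    refine hne i ?_
    have h1 := mem_degreeLT.mp (hx.1 (hgx i))
    exact coeff_eq_zero_of_degree_lt (h1.trans_le (by exact_mod_cast hcon))
  · intro i m
    apply hdim
    intro v
    simp only [Fflag, Submodule.mem_inf, Submodule.restrictScalars_mem, Ideal.mem_span_singleton,
      X_pow_dvd_iff, lcoeff_apply]
    exact ⟨fun h => ⟨h.1, h.2.2⟩, fun h => ⟨h.1, hx.1 h.1, h.2⟩⟩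

theorem aux_high (n d : ℕ) (x : Submodule ℂ (Polynomial ℂ)) (hx : IsGrPoint n d x)
    [FiniteDimensional ℂ x] :
    ∃ (s : Fin d → ℕ) (g : Fin d → Polynomial ℂ), StrictMono s ∧ (∀ i, s i < n) ∧
      Submodule.span ℂ (Set.range g) = x ∧ (∀ i, (g i).natDegree ≤ s i) ∧
      (∀ i, (g i).coeff (s i) ≠ 0) ∧
      (∀ (i : Fin d) (t : ℕ), (i : ℕ) + 1 ≤ Module.finrank ℂ ↥(x ⊓ Ftilde t) ↔ s i < t) := by
  have hbig : ∀ v ∈ x, ∀ k, n ≤ k → v.coeff k = 0 := by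
    intro v hv k hk
    have h1 := mem_degreeLT.mp (hx.1 hv)
    exact coeff_eq_zero_of_degree_lt (h1.trans_le (by exact_mod_cast hk))
  obtain ⟨b, g, hb, hg, hgx, hlow, hne, hdim⟩ := aux_echelon
    (fun k => if k < n then lcoeff ℂ (n - 1 - k) else 0) d x hx.2
    inferInstance (fun v hvx hv => by
      ext k
      by_cases hk : k < n
      · have := hv (n - 1 - k)
        rw [if_pos (by omega)] at this
        have h2 : n - 1 - (n - 1 - k) = k := by omega
        rw [h2] at this
        simpa using this
      · simpa using hbig v hvx k (by omega))
  have hbn : ∀ i, b i < n := by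
    intro i
    by_contra hcon
    exact hne i (by rw [if_neg hcon]; rfl)
  refine ⟨fun i => n - 1 - b i.rev, fun i => g i.rev, ?_, ?_, ?_, ?_, ?_, ?_⟩
  · intro i j hij
    have h1 := hb (Fin.rev_lt_rev.mpr hij)
    have h2 := hbn i.rev
    have h3 := hbn j.rev
    show n - 1 - b i.rev < n - 1 - b j.rev
    omega
  · intro i
    have := hbn i.rev
    show n - 1 - b i.rev < n
    omega
  · refine aux_span_eq hx.2 _ (hg.comp _ Fin.rev_injective) (fun i => hgx _)
  · intro i
    rw [natDegree_le_iff_coeff_eq_zero]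
    intro k hk
    change n - 1 - b i.rev < k at hk
    by_cases hkn : k < n
    · have := hlow i.rev (n - 1 - k) (by have := hbn i.rev; omega)
      rw [if_pos (by omega)] at this
      have h2 : n - 1 - (n - 1 - k) = k := by omega
      rw [h2] at this
      simpa using this
    · exact hbig _ (hgx _) k (by omega)
  · intro i
    have := hne i.rev
    rw [if_pos (hbn _)] at this
    exact this
  · intro i t
    have h1 := hdim i.rev (n - t) (x ⊓ Ftilde t) (by
      intro v
      simp only [Ftilde, Submodule.mem_inf, mem_degreeLT, degree_lt_iff_coeff_zero]
      refine and_congr_right fun hv => ⟨fun h k hk => ?_, fun h k hk => ?_⟩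
      · rw [if_pos (by omega)]
        exact h _ (by omega)
      · by_cases hkn : k < n
        · have := h (n - 1 - k) (by omega)
          rw [if_pos (by omega)] at this
          have h2 : n - 1 - (n - 1 - k) = k := by omega
          rw [h2] at this
          exact this
        · exact hbig v hv k (by omega))
    have h2 : d - ((i.rev : Fin d) : ℕ) = (i : ℕ) + 1 := by
      rw [Fin.val_rev]; omega
    rw [h2] at h1
    rw [h1]
    have := hbn i.rev
    show _ ↔ n - 1 - b i.rev < t
    omega

theorem aux_gap {d : ℕ} (s : Fin d → ℕ) (hs : StrictMono s) (i j : Fin d) (hij : i ≤ j) :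
    s i + ((j : ℕ) - (i : ℕ)) ≤ s j := by
  obtain ⟨i, hi⟩ := i
  obtain ⟨j, hj⟩ := j
  simp only [Fin.mk_le_mk] at hij
  induction j, hij using Nat.le_induction with
  | base => simp
  | succ j hij ih =>
    have h1 := ih (by omega)
    have h2 : s ⟨j, by omega⟩ < s ⟨j + 1, hj⟩ := hs (by simp)
    simp only at h1 ⊢
    omega

theorem aux_part {d n : ℕ} (s : Fin d → ℕ) (hs : StrictMono s) (hsn : ∀ i, s i < n) :
    ∃ p : PartitionIn d (n - d), ∀ i : Fin d, p.part (d - 1 - (i : ℕ)) + (i : ℕ) = s i := by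
  have hge : ∀ i : Fin d, (i : ℕ) ≤ s i := by
    intro i
    have := aux_gap s hs ⟨0, by have := i.2; omega⟩ i (by simp [Fin.le_def])
    simp only at this
    omega
  refine ⟨⟨fun k => if hk : k < d then s ⟨d - 1 - k, by omega⟩ - (d - 1 - k) else 0,
    ?_, ?_, ?_⟩, ?_⟩
  · intro i j hij
    by_cases hj : j < d
    · have hi : i < d := by omega
      simp only [hi, hj, dif_pos]
      have := aux_gap s hs ⟨d - 1 - j, by omega⟩ ⟨d - 1 - i, by omega⟩
        (by simp only [Fin.mk_le_mk]; omega)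
      simp only at this
      omega
    · simp [hj]
  · intro i
    by_cases hi : i < d
    · simp only [hi, dif_pos]
      have := aux_gap s hs ⟨d - 1 - i, by omega⟩ ⟨d - 1, by omega⟩
        (by simp only [Fin.mk_le_mk]; omega)
      have h2 := hsn ⟨d - 1, by omega⟩
      simp only at this
      omega
    · simp [hi]
  · intro i hi
    simp [Nat.not_lt.mpr hi]
  · intro i
    have hi := i.2
    have h1 : d - 1 - (i : ℕ) < d := by omega
    have h2 : d - 1 - (d - 1 - (i : ℕ)) = i := by omega
    simp only [h1, dif_pos, h2, Fin.eta]
    exact Nat.sub_add_cancel (hge i)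

theorem aux_size {d w : ℕ} (p : PartitionIn d w) :
    p.size + ∑ i : Fin d, (i : ℕ) = ∑ i : Fin d, (p.part (d - 1 - (i : ℕ)) + (i : ℕ)) := by
  rw [Finset.sum_add_distrib, PartitionIn.size, ← Finset.sum_range_reflect,
    Finset.sum_range (fun j => p.part (d - 1 - j))]

theorem aux_ext {d w : ℕ} (p q : PartitionIn d w)
    (h : ∀ i : Fin d, p.part (d - 1 - (i : ℕ)) = q.part (d - 1 - (i : ℕ))) : p = q := by
  have : p.part = q.part := by
    funext k
    by_cases hk : k < d
    · have := h ⟨d - 1 - k, by omega⟩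
      have h2 : d - 1 - (d - 1 - k) = k := by omega
      simpa only [h2] using this
    · rw [p.eq_zero k (by omega), q.eq_zero k (by omega)]
  cases p; cases q
  cases this
  rfl

theorem aux_eq_of_le {d w : ℕ} (p q : PartitionIn d w)
    (h : ∀ i : Fin d, p.part (d - 1 - (i : ℕ)) ≤ q.part (d - 1 - (i : ℕ)))
    (hs : p.size = q.size) : p = q := by
  apply aux_ext
  have h1 := aux_size p
  have h2 := aux_size q
  rw [Finset.sum_add_distrib] at h1 h2
  have h3 : ∑ i : Fin d, p.part (d - 1 - (i : ℕ)) = ∑ i : Fin d, q.part (d - 1 - (i : ℕ)) := by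
    omega
  intro i
  exact (Finset.sum_eq_sum_iff_of_le (fun i _ => h i)).mp h3 i (Finset.mem_univ i)

/-- For every nonzero polynomial `h ∈ ℙ(ℂ_N[z])`, every point
`x` in the fibre `X(h) = Wr⁻¹(h)` lies in a unique `h`-compatible Richardson
variety `X_{λ/μ}`. -/
theorem statement9 (d n : ℕ) (hd : 0 < d) (hdn : d < n)
    (h : Polynomial ℂ) (hne : h ≠ 0) (hdeg : h.natDegree ≤ d * (n - d)) :
    ∀ x : Submodule ℂ (Polynomial ℂ), IsGrPoint n d x → InFibre d x h →
      ∃! p : PartitionIn d (n - d) × PartitionIn d (n - d),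
        Compatible n d p.1 p.2 h ∧ InRichardson n d p.1 p.2 x := by
  intro x hx hfib
  obtain ⟨f, c, hc, -, hfx, hw⟩ := hfib
  have hfd : FiniteDimensional ℂ x := by
    apply Module.finite_of_finrank_pos
    rw [hx.2]; exact hd
  obtain ⟨a, g, ha, han, hgx, hlow, hgne, hdimF⟩ := aux_low n d x hx
  obtain ⟨s, g', hs, hsn, hgx', hdeg', hgne', hdimT⟩ := aux_high n d x hx
  obtain ⟨mu, hmu⟩ := aux_part a ha han
  obtain ⟨lam, hlam⟩ := aux_part s hs hsn
  have hmem : ∀ i, f i ∈ x := fun i => hfx ▸ Submodule.subset_span ⟨i, rfl⟩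
  have hroot := (aux_wronsk_h d f g h c hc hne hw (fun i => hgx ▸ hmem i)).2
  have hnat := (aux_wronsk_h d f g' h c hc hne hw (fun i => hgx' ▸ hmem i)).1
  have hmusize : mu.size = h.rootMultiplicity 0 := by
    have h1 := aux_rootMult_wronsk d g a ha.injective hlow hgne
    have h2 := aux_size mu
    simp only [hmu] at h2
    omega
  have hlamsize : lam.size = h.natDegree := by
    have h1 := (aux_natDegree_wronsk d g' s hs.injective hdeg' hgne').2
    have h2 := aux_size lam
    simp only [hlam] at h2
    omega
  -- comparison of the two exponent sequences
  have has : ∀ i, a i ≤ s i := by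
    intro i
    have h1 := (hdimF i (n - a i)).mpr (by omega)
    have h2 := (hdimT i (s i + 1)).mpr (by omega)
    have h3 := Submodule.finrank_sup_add_finrank_inf_eq (x ⊓ Fflag n (n - a i))
      (x ⊓ Ftilde (s i + 1))
    have h4 : Module.finrank ℂ ↥((x ⊓ Fflag n (n - a i)) ⊔ (x ⊓ Ftilde (s i + 1)))
        ≤ Module.finrank ℂ x :=
      Submodule.finrank_mono (sup_le inf_le_left inf_le_left)
    rw [hx.2] at h4
    have hi := i.2
    have h5 : (x ⊓ Fflag n (n - a i)) ⊓ (x ⊓ Ftilde (s i + 1)) ≠ ⊥ := by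
      intro h0
      rw [h0, finrank_bot] at h3
      omega
    obtain ⟨v, hv, hv0⟩ := Submodule.exists_mem_ne_zero_of_ne_bot h5
    simp only [Fflag, Ftilde, Submodule.mem_inf, Submodule.restrictScalars_mem,
      Ideal.mem_span_singleton, X_pow_dvd_iff, mem_degreeLT] at hv
    obtain ⟨⟨-, -, hv1⟩, -, hv2⟩ := hv
    by_contra hcon
    push Not at hcon
    have h6 := (natDegree_lt_iff_degree_lt hv0).mpr hv2
    exact hv0 (leadingCoeff_eq_zero.mp (hv1 v.natDegree (by have := han i; omega)))
  -- the Richardson conditions in terms of the exponent sequences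
  have hrich : ∀ l m : PartitionIn d (n - d), InRichardson n d l m x ↔
      ((∀ i : Fin d, m.part (d - 1 - (i : ℕ)) + (i : ℕ) ≤ a i) ∧
        ∀ i : Fin d, s i ≤ l.part (d - 1 - (i : ℕ)) + (i : ℕ)) := by
    intro l m
    have hA : ∀ k (hk : k < d), (k + 1 ≤ Module.finrank ℂ
        ↥(x ⊓ Fflag n (n - d - m.part k + (k + 1))) ↔
        m.part k + (d - 1 - k) ≤ a ⟨d - 1 - k, by omega⟩) := by
      intro k hk
      have h1 := hdimF ⟨d - 1 - k, by omega⟩ (n - d - m.part k + (k + 1))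
      have h2 : d - (d - 1 - k) = k + 1 := by omega
      have h3 := m.le_w k
      have h4 : n - (n - d - m.part k + (k + 1)) = m.part k + (d - 1 - k) := by omega
      simp only [h2, h4] at h1
      exact h1
    have hB : ∀ k (hk : k < d), (k + 1 ≤ Module.finrank ℂ
        ↥(x ⊓ Ftilde (l.part (d - 1 - k) + (k + 1))) ↔
        s ⟨k, hk⟩ ≤ l.part (d - 1 - k) + k) := by
      intro k hk
      have h1 := hdimT ⟨k, hk⟩ (l.part (d - 1 - k) + (k + 1))
      simp only at h1
      rw [h1]
      omega
    constructor
    · intro hR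
      refine ⟨fun i => ?_, fun i => (hB i i.2).mp (hR i i.2).2⟩
      have hi := i.2
      have h1 := (hA (d - 1 - i) (by omega)).mp (hR (d - 1 - i) (by omega)).1
      have h2 : d - 1 - (d - 1 - (i : ℕ)) = i := by omega
      simpa only [h2, Fin.eta] using h1
    · rintro ⟨h1, h2⟩ k hk
      refine ⟨(hA k hk).mpr ?_, (hB k hk).mpr (h2 ⟨k, hk⟩)⟩
      have h3 := h1 ⟨d - 1 - k, by omega⟩
      have h4 : d - 1 - (d - 1 - k) = k := by omega
      simpa only [h4] using h3
  refine ⟨(lam, mu), ⟨⟨?_, hlamsize, hmusize⟩, ?_⟩, ?_⟩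
  · intro k
    by_cases hk : k < d
    · have h1 := hmu ⟨d - 1 - k, by omega⟩
      have h2 := hlam ⟨d - 1 - k, by omega⟩
      have h3 := has ⟨d - 1 - k, by omega⟩
      have h4 : d - 1 - (d - 1 - k) = k := by omega
      simp only [h4] at h1 h2
      show mu.part k ≤ lam.part k
      omega
    · show mu.part k ≤ lam.part k
      rw [mu.eq_zero k (by omega)]
      exact Nat.zero_le _
  · exact (hrich lam mu).mpr ⟨fun i => (hmu i).le, fun i => (hlam i).ge⟩
  · rintro ⟨l, m⟩ ⟨⟨-, hl, hm⟩, hR⟩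
    obtain ⟨h1, h2⟩ := (hrich l m).mp hR
    simp only at hl hm
    refine Prod.ext ?_ ?_
    · refine (aux_eq_of_le lam l (fun i => ?_) (hlamsize.trans hl.symm)).symm
      have := h2 i
      have := hlam i
      omega
    · refine aux_eq_of_le m mu (fun i => ?_) (hm.trans hmusize.symm)
      have := h1 i
      have := hmu i
      omega
end

section
/- Let h be a polynomial of degree at most N with real coefficients whose roots are all purely imaginary numbers. Then the real points in the fibre X(h) = Wr^{−1}(h) are exactly the points of X(h) fixed by the involution of X induced by the element diag(−1,1) ∈ PGL_2(ℂ) (the substitution z ↦ −z). -/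
open Polynomial

namespace Gaudin
open Equiv
open scoped Matrix

section
variable {n : ℕ} {R : Type*} [CommRing R]

/-- Calogero-Moser matrix. -/
def cm (q : Fin n → Fin n → R) (μ : Fin n → R) : Matrix (Fin n) (Fin n) R :=
  Matrix.of fun i j => if i = j then μ i else - q i j

/-- Right translation matrix. -/
def pm (π : Perm (Fin n)) : Matrix (Perm (Fin n)) (Perm (Fin n)) R :=
  Matrix.of fun σ τ => if τ = σ * π then 1 else 0

/-- Gaudin Hamiltonian. -/
def hm (q : Fin n → Fin n → R) (k : Fin n → R) (i : Fin n) :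
    Matrix (Perm (Fin n)) (Perm (Fin n)) R :=
  Matrix.diagonal (fun σ => k (σ i)) + ∑ j, q i j • pm (swap i j)

lemma pm_mul (π ρ : Perm (Fin n)) : (pm π * pm ρ : Matrix _ _ R) = pm (π * ρ) := by
  ext σ τ
  simp only [pm, Matrix.mul_apply, Matrix.of_apply]
  rw [Finset.sum_eq_single (σ * π)]
  · simp [mul_assoc]
  · intro b _ hb; simp [hb]
  · simp

lemma pm_transpose_swap (i j : Fin n) :
    (pm (swap i j) : Matrix _ _ R)ᵀ = pm (swap i j) := by
  ext σ τ
  simp only [pm, Matrix.transpose_apply, Matrix.of_apply]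
  congr 1
  apply propext
  constructor
  · rintro rfl; simp [mul_assoc]
  · rintro rfl; simp [mul_assoc]

lemma pm_diag (k : Fin n → R) (π : Perm (Fin n)) (j : Fin n) :
    (pm π * Matrix.diagonal (fun σ : Perm (Fin n) => k (σ j)) : Matrix _ _ R)
      = Matrix.diagonal (fun σ => k (σ (π j))) * pm π := by
  ext σ τ
  simp only [pm, Matrix.mul_diagonal, Matrix.diagonal_mul, Matrix.of_apply]
  split_ifs with h
  · subst h; simp
  · simp

lemma hm_transpose (q : Fin n → Fin n → R) (k : Fin n → R) (i : Fin n) :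
    (hm q k i)ᵀ = hm q k i := by
  simp [hm, Matrix.transpose_add, Matrix.transpose_sum, pm_transpose_swap]

lemma swaps_aux (q : Fin n → Fin n → R) (hq : ∀ i j, q i j = - q j i)
    (hq0 : ∀ i, q i i = 0)
    (hA : ∀ i j l, i ≠ j → j ≠ l → i ≠ l →
      q i j * q j l = q i l * q i j + q i l * q j l) (i j : Fin n) (hij : i ≠ j) :
    ∑ l, ∑ m, (q i l * q j m) • (pm (swap i l) * pm (swap j m)
        - pm (swap j m) * pm (swap i l) : Matrix (Perm (Fin n)) (Perm (Fin n)) R) = 0 := by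
  set T : Fin n → Fin n → Matrix (Perm (Fin n)) (Perm (Fin n)) R := fun l m =>
    (q i l * q j m) • (pm (swap i l) * pm (swap j m) - pm (swap j m) * pm (swap i l)) with hT
  have h1 : ∀ l m, T l m = (if l = j then T j m else 0) + (if m = i then T l i else 0)
      + (if l = m then T l l else 0) := by
    intro l m
    by_cases hl : l = j
    · subst hl
      by_cases hm : m = i
      · subst hm
        have : T l m = 0 := by simp [hT, swap_comm l m]
        simp [this, hij.symm]
      · by_cases hlm : l = m
        · subst hlm
          have : T l l = 0 := by simp [hT, hq0]
          simp [this, hm]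
        · simp [hm, hlm]
    · by_cases hm : m = i
      · subst hm
        by_cases hlm : l = m
        · subst hlm
          have : T l l = 0 := by simp [hT, hq0]
          simp [this, hl]
        · simp [hl, hlm]
      · by_cases hlm : l = m
        · subst hlm; simp [hl, hm]
        · simp only [hl, hm, hlm, if_false, add_zero]
          by_cases hli : l = i
          · subst hli; simp [hT, hq0]
          by_cases hmj : m = j
          · subst hmj; simp [hT, hq0]
          have hd : Perm.Disjoint (swap i l) (swap j m) := by
            intro x
            by_cases hx : x = i ∨ x = l
            · right
              rcases hx with rfl | rfl
              · exact swap_apply_of_ne_of_ne hij (Ne.symm hm)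
              · exact swap_apply_of_ne_of_ne hl hlm
            · push Not at hx
              left; exact swap_apply_of_ne_of_ne hx.1 hx.2
          simp [hT, pm_mul, hd.commute.eq]
  have h2 : ∑ l, ∑ m, T l m = ∑ l, (T j l + T l i + T l l) := by
    rw [Finset.sum_congr rfl fun l _ => Finset.sum_congr rfl fun m _ => h1 l m]
    simp only [Finset.sum_add_distrib]
    congr 1
    · congr 1
      · rw [Finset.sum_comm]
        simp
      · simp
    · simp
  rw [h2]
  apply Finset.sum_eq_zero
  intro l _
  by_cases hli : l = i
  · subst hli; simp [hT, hq0, swap_comm j l]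
  by_cases hlj : l = j
  · subst hlj; simp [hT, hq0, swap_comm i l]
  have e1 : swap i l * swap j i = swap i j * swap j l := by
    rw [swap_comm j i]
    ext x
    by_cases hx : x = i
    · subst hx; simp [swap_apply_of_ne_of_ne, hij, hli, hlj, Ne.symm hli, Ne.symm hlj, hij.symm]
    by_cases hx : x = j
    · subst hx; simp [swap_apply_of_ne_of_ne, hij, hli, hlj, Ne.symm hli, Ne.symm hlj, hij.symm]
    by_cases hx : x = l
    · subst hx; simp [swap_apply_of_ne_of_ne, hij, hli, hlj, Ne.symm hli, Ne.symm hlj, hij.symm]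
    simp [swap_apply_of_ne_of_ne, *]
  have e2 : swap j i * swap i l = swap j l * swap i j := by
    have := congrArg (·⁻¹) e1
    simpa using this
  have e3 : swap i l * swap j l = swap j l * swap i j := by
    ext x
    by_cases hx : x = i
    · subst hx; simp [swap_apply_of_ne_of_ne, hij, hli, hlj, Ne.symm hli, Ne.symm hlj, hij.symm]
    by_cases hx : x = j
    · subst hx; simp [swap_apply_of_ne_of_ne, hij, hli, hlj, Ne.symm hli, Ne.symm hlj, hij.symm]
    by_cases hx : x = l
    · subst hx; simp [swap_apply_of_ne_of_ne, hij, hli, hlj, Ne.symm hli, Ne.symm hlj, hij.symm]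
    simp [swap_apply_of_ne_of_ne, *]
  have e4 : swap j l * swap i l = swap i j * swap j l := by
    have := congrArg (·⁻¹) e3
    simpa using this
  simp only [hT, pm_mul, e1, e2, e3, e4]
  have := hA i j l hij (Ne.symm hlj) (Ne.symm hli)
  rw [this, hq j i]
  module

lemma hm_commute (q : Fin n → Fin n → R) (hq : ∀ i j, q i j = - q j i)
    (hq0 : ∀ i, q i i = 0)
    (hA : ∀ i j l, i ≠ j → j ≠ l → i ≠ l →
      q i j * q j l = q i l * q i j + q i l * q j l) (k : Fin n → R) (i j : Fin n) :
    hm q k i * hm q k j = hm q k j * hm q k i := by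
  by_cases hij : i = j
  · subst hij; rfl
  have h1 := swaps_aux q hq hq0 hA i j hij
  set D : Fin n → Matrix (Perm (Fin n)) (Perm (Fin n)) R :=
    fun i => Matrix.diagonal (fun σ => k (σ i)) with hD
  have hDD : D i * D j = D j * D i := by
    simp only [hD, Matrix.diagonal_mul_diagonal]; congr 1; ext; ring
  have hPD : ∀ π j, pm π * D j = D (π j) * pm π := fun π j => pm_diag k π j
  have e : ∀ i, hm q k i = D i + ∑ j, q i j • pm (swap i j) := fun _ => rfl
  -- mixed terms
  have h2 : ∀ i j : Fin n, i ≠ j → (∑ l, q i l • pm (swap i l)) * D j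
      - D j * (∑ l, q i l • pm (swap i l)) = q i j • ((D i - D j) * pm (swap i j)) := by
    intro i j hij
    rw [Finset.sum_mul, Finset.mul_sum, ← Finset.sum_sub_distrib,
      Finset.sum_eq_single j]
    · rw [Matrix.smul_mul, hPD, Matrix.mul_smul, swap_apply_right, ← smul_sub, sub_mul]
    · intro l _ hl
      rw [Matrix.smul_mul, hPD, Matrix.mul_smul, swap_apply_of_ne_of_ne (Ne.symm hij) (Ne.symm hl), sub_self]
    · simp
  have h3 : (∑ l, q i l • pm (swap i l)) * (∑ m, q j m • pm (swap j m))
      - (∑ m, q j m • pm (swap j m)) * (∑ l, q i l • pm (swap i l)) = 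
      (0 : Matrix (Perm (Fin n)) (Perm (Fin n)) R) := by
    rw [← h1, Finset.sum_mul_sum, Finset.sum_mul_sum]
    rw [Finset.sum_comm (f := fun m l => (q j m • pm (swap j m)) * (q i l • pm (swap i l)))]
    rw [← Finset.sum_sub_distrib]
    refine Finset.sum_congr rfl fun l _ => ?_
    rw [← Finset.sum_sub_distrib]
    refine Finset.sum_congr rfl fun m _ => ?_
    simp only [Matrix.smul_mul, Matrix.mul_smul, smul_smul, smul_sub]
    rw [mul_comm (q j m)]
  have h4 := h2 i j hij
  have h5 := h2 j i (Ne.symm hij)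
  rw [hq j i, swap_comm j i] at h5
  rw [← sub_eq_zero, e, e]
  have : ∀ A B X Y : Matrix (Perm (Fin n)) (Perm (Fin n)) R,
     (A + X) * (B + Y) - (B + Y) * (A + X) = (A * B - B * A) + (X * B - B * X) - (Y * A - A * Y)
       + (X * Y - Y * X) := by intros; noncomm_ring
  rw [this, h3, h4, h5, hDD]
  simp only [sub_mul]
  module

end
end Gaudin

namespace Gaudin
open Equiv
open scoped Matrix
section
variable {n : ℕ}

lemma exists_eig (q : Fin n → Fin n → ℝ) (hq : ∀ i j, q i j = - q j i)
    (hq0 : ∀ i, q i i = 0)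
    (hA : ∀ i j l, i ≠ j → j ≠ l → i ≠ l →
      q i j * q j l = q i l * q i j + q i l * q j l) (k : Fin n → ℝ) :
    ∃ (v : Perm (Fin n) → ℝ) (μ : Fin n → ℝ),
      (∀ i, hm q k i *ᵥ v = μ i • v) ∧ ∑ σ, v σ ≠ 0 := by
  by_contra hcon
  push Not at hcon
  let T : Fin n → EuclideanSpace ℝ (Perm (Fin n)) →ₗ[ℝ] EuclideanSpace ℝ (Perm (Fin n)) :=
    fun i => Matrix.toEuclideanLin (hm q k i)
  have hT : ∀ i, (T i).IsSymmetric := by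
    intro i
    apply Matrix.isSymmetric_toEuclideanLin_iff.mpr
    rw [Matrix.IsHermitian, Matrix.conjTranspose_eq_transpose_of_trivial, hm_transpose]
  have hC : Pairwise (Function.onFun Commute T) := by
    intro i j _
    have h := hm_commute q hq hq0 hA k i j
    show T i ∘ₗ T j = T j ∘ₗ T i
    ext v : 1
    have := congrArg (fun M => M *ᵥ v.ofLp) h
    simpa [T, Matrix.toLpLin_apply, Matrix.mulVec_mulVec] using this
  have htop := LinearMap.IsSymmetric.iSup_iInf_eq_top_of_commute hT hC
  let φ : EuclideanSpace ℝ (Perm (Fin n)) →ₗ[ℝ] ℝ :=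
    { toFun := fun v => ∑ σ, v σ
      map_add' := by intro x y; simp [Finset.sum_add_distrib]
      map_smul' := by intro c x; simp [Finset.mul_sum] }
  have hle : (⊤ : Submodule ℝ (EuclideanSpace ℝ (Perm (Fin n)))) ≤ LinearMap.ker φ := by
    rw [← htop]
    apply iSup_le
    intro χ v hv
    rw [Submodule.mem_iInf] at hv
    refine hcon v.ofLp χ ?_
    intro i
    have := hv i
    rw [Module.End.mem_eigenspace_iff] at this
    have := congrArg (WithLp.ofLp) this
    simpa [T, Matrix.toLpLin_apply] using this
  have h1 := hle (x := WithLp.toLp 2 (Pi.single 1 1)) trivial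
  rw [LinearMap.mem_ker] at h1
  simp [φ] at h1

lemma eig_cm (q : Fin n → Fin n → ℝ) (hq0 : ∀ i, q i i = 0) (k : Fin n → ℝ)
    (v : Perm (Fin n) → ℝ) (μ : Fin n → ℝ)
    (hv : ∀ i, hm q k i *ᵥ v = μ i • v) (a : Fin n) :
    cm q μ *ᵥ (fun i => ∑ σ, if σ i = a then v σ else 0)
      = k a • (fun i => ∑ σ : Perm (Fin n), if σ i = a then v σ else 0) := by
  set x : Fin n → ℝ := fun i => ∑ σ : Perm (Fin n), if σ i = a then v σ else 0 with hx
  have hv' : ∀ i σ, k (σ i) * v σ + ∑ j, q i j * v (σ * swap i j) = μ i * v σ := by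
    intro i σ
    have := congrFun (hv i) σ
    rw [hm, Matrix.add_mulVec, Pi.add_apply, Matrix.mulVec_diagonal, Matrix.sum_mulVec,
      Finset.sum_apply] at this
    simpa [pm, Matrix.smul_mulVec, Matrix.mulVec, dotProduct] using this
  have key : ∀ i, μ i * x i = k a * x i + ∑ j, q i j * x j := by
    intro i
    have h1 : μ i * x i = ∑ σ : Perm (Fin n), if σ i = a then μ i * v σ else 0 := by
      simp [hx, Finset.mul_sum]
    rw [h1]
    simp_rw [← hv']
    have h2 : ∀ j, q i j * x j = ∑ σ : Perm (Fin n), if σ i = a then q i j * v (σ * swap i j) else 0 := by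
      intro j
      rw [hx, Finset.mul_sum]
      refine (Fintype.sum_equiv (Equiv.mulRight (swap i j)) _ _ fun σ => ?_).symm
      simp
    simp_rw [h2]
    rw [Finset.sum_comm, hx, Finset.mul_sum, ← Finset.sum_add_distrib]
    refine Finset.sum_congr rfl fun σ _ => ?_
    split_ifs with h
    · rw [h]
    · simp
  ext i
  simp only [Matrix.mulVec, dotProduct, cm, Matrix.of_apply, Pi.smul_apply, smul_eq_mul]
  have : ∀ j, (if i = j then μ i else - q i j) * x j = (if i = j then μ i * x i else 0) - q i j * x j := by
    intro j
    split_ifs with h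
    · subst h; simp [hq0]
    · ring
  simp_rw [this]
  rw [Finset.sum_sub_distrib]
  simp [key i]

lemma charpoly_cm_of_eig (q : Fin n → Fin n → ℝ) (hq0 : ∀ i, q i i = 0) (k : Fin n → ℝ)
    (hk : Function.Injective k)
    (v : Perm (Fin n) → ℝ) (μ : Fin n → ℝ)
    (hv : ∀ i, hm q k i *ᵥ v = μ i • v) (hs : ∑ σ, v σ ≠ 0) :
    (cm q μ).charpoly = ∏ a, (X - C (k a)) := by
  have hroot : ∀ a, (cm q μ).charpoly.IsRoot (k a) := by
    intro a
    have h1 := eig_cm q hq0 k v μ hv a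
    set x : Fin n → ℝ := fun i => ∑ σ : Perm (Fin n), if σ i = a then v σ else 0 with hx
    have hx0 : x ≠ 0 := by
      intro h0
      apply hs
      have : ∑ i, x i = ∑ σ, v σ := by
        rw [hx, Finset.sum_comm]
        refine Finset.sum_congr rfl fun σ _ => ?_
        rw [Finset.sum_eq_single (σ⁻¹ a)]
        · simp
        · intro b _ hb
          rw [if_neg]
          rintro rfl; simp at hb
        · simp
      rw [← this, h0]; simp
    rw [← Matrix.charpoly_toLin'] 
    rw [← Module.End.hasEigenvalue_iff_isRoot_charpoly]
    apply Module.End.hasEigenvalue_of_hasEigenvector (x := x)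
    rw [Module.End.hasEigenvector_iff]
    exact ⟨by rw [Module.End.mem_eigenspace_iff]; simpa using h1, hx0⟩
  have hm : ∀ a ∈ (Finset.univ : Finset (Fin n)), (X - C (k a)).Monic := fun a _ => monic_X_sub_C _
  have hdvd : ∏ a, (X - C (k a)) ∣ (cm q μ).charpoly := by
    apply Finset.prod_dvd_of_coprime
    · intro a _ b _ hab
      exact Polynomial.pairwise_coprime_X_sub_C hk hab
    · intro a _
      exact dvd_iff_isRoot.mpr (hroot a)
  refine (Polynomial.eq_of_monic_of_dvd_of_natDegree_le (monic_prod_of_monic _ _ hm)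
    (Matrix.charpoly_monic _) hdvd ?_)
  rw [Matrix.charpoly_natDegree_eq_dim, natDegree_prod_of_monic _ _ hm]
  simp
end
end Gaudin

namespace Gaudin
open Equiv
open scoped Matrix
section
variable {n : ℕ}

lemma dim_aux {n : ℕ} (F : MvPolynomial (Fin n) ℝ) (Φ : Fin n → MvPolynomial (Fin n) ℝ)
    (H : ∀ k : Fin n → ℝ, Function.Injective k → ∃ μ : Fin n → ℝ,
      MvPolynomial.eval μ F = 0 ∧ ∀ l : Fin n, MvPolynomial.eval μ (Φ l)
        = MvPolynomial.eval k (MvPolynomial.esymm (Fin n) ℝ (l + 1))) : F = 0 := by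
  by_contra hF
  let y : Option (Fin n) → MvPolynomial (Fin n) ℝ := fun o => o.elim F Φ
  have hdep : ¬ AlgebraicIndependent ℝ y := by
    intro h
    have := h.cardinalMk_le_trdeg
    rw [MvPolynomial.trdeg_of_isDomain] at this
    simp only [Cardinal.mk_fintype, Fintype.card_option, Fintype.card_fin, Cardinal.lift_natCast] at this
    have := Nat.cast_le.mp this
    omega
  rw [algebraicIndependent_iff] at hdep
  push Not at hdep
  obtain ⟨Q, hQ, hQ0⟩ := hdep
  let ψ : Polynomial (MvPolynomial (Fin n) ℝ) →ₐ[ℝ] MvPolynomial (Fin n) ℝ :=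
    { Polynomial.eval₂RingHom (MvPolynomial.aeval Φ : MvPolynomial (Fin n) ℝ →ₐ[ℝ] _).toRingHom F with
      commutes' := by
        intro r
        simp [Polynomial.algebraMap_apply] }
  have hψa : ∀ p, ψ p = p.eval₂ (MvPolynomial.aeval Φ : MvPolynomial (Fin n) ℝ →ₐ[ℝ] _).toRingHom F :=
    fun _ => rfl
  have hψ : ψ.comp (MvPolynomial.optionEquivLeft ℝ (Fin n)).toAlgHom = MvPolynomial.aeval y := by
    apply MvPolynomial.algHom_ext
    rintro (_ | i)
    · simp [hψa, y]
    · simp [hψa, y]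
  set p := MvPolynomial.optionEquivLeft ℝ (Fin n) Q with hp
  have hp0 : p ≠ 0 := by simpa [hp] using hQ0
  have hψp : ψ p = 0 := by
    rw [← hQ, ← hψ]; rfl
  obtain ⟨p', hpp, hnd⟩ := Polynomial.exists_eq_pow_rootMultiplicity_mul_and_not_dvd p hp0 0
  have hψp' : ψ p' = 0 := by
    rw [hpp, map_mul, map_pow] at hψp
    have h1 : ψ (X - C 0) = F := by simp [hψa]
    rw [h1] at hψp
    exact (mul_eq_zero.mp hψp).resolve_left (pow_ne_zero _ hF)
  have hc0 : p'.coeff 0 ≠ 0 := by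
    intro h
    apply hnd
    simpa [Polynomial.X_dvd_iff] using h
  let G : MvPolynomial (Fin n) ℝ :=
    MvPolynomial.aeval (fun l : Fin n => MvPolynomial.esymm (Fin n) ℝ (l + 1)) (p'.coeff 0)
  have hG : G ≠ 0 := by
    intro h
    apply hc0
    apply (MvPolynomial.esymmAlgHom_fin_bijective (R := ℝ) n).1
    apply Subtype.ext
    rw [MvPolynomial.esymmAlgHom_apply, map_zero]
    exact h
  let D : MvPolynomial (Fin n) ℝ :=
    ∏ i, ∏ j ∈ Finset.univ.erase i, (MvPolynomial.X i - MvPolynomial.X j)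
  have hD : D ≠ 0 := by
    refine Finset.prod_ne_zero_iff.mpr fun i _ => Finset.prod_ne_zero_iff.mpr fun j hj => ?_
    rw [sub_ne_zero]
    intro h
    exact (Finset.ne_of_mem_erase hj) (MvPolynomial.X_injective h).symm
  apply mul_ne_zero hG hD
  apply MvPolynomial.funext
  intro k
  rw [map_mul, map_zero]
  by_cases hk : Function.Injective k
  · obtain ⟨μ, h1, h2⟩ := H k hk
    have h3 := congrArg (MvPolynomial.eval μ) hψp'
    have h4 : MvPolynomial.eval μ (ψ p') = MvPolynomial.eval k G := by
      have e1 : ψ p' = p'.eval₂ (MvPolynomial.aeval Φ : MvPolynomial (Fin n) ℝ →ₐ[ℝ] _).toRingHom F := rfl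
      rw [e1, Polynomial.hom_eval₂, h1, Polynomial.eval₂_at_zero]
      show MvPolynomial.eval μ (MvPolynomial.aeval Φ (p'.coeff 0)) = _
      simp only [G]
      rw [← MvPolynomial.coe_aeval_eq_eval, ← MvPolynomial.coe_aeval_eq_eval]
      simp only [RingHom.coe_coe]
      rw [← AlgHom.comp_apply, ← AlgHom.comp_apply, MvPolynomial.comp_aeval, MvPolynomial.comp_aeval]
      congr 2
      funext l
      exact h2 l
    rw [h4, map_zero] at h3
    rw [h3, zero_mul]
  · rw [Function.not_injective_iff] at hk
    obtain ⟨a, b, hab, hne⟩ := hk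
    have : MvPolynomial.eval k D = 0 := by
      simp only [D, map_prod]
      apply Finset.prod_eq_zero (Finset.mem_univ a)
      apply Finset.prod_eq_zero (Finset.mem_erase.mpr ⟨Ne.symm hne, Finset.mem_univ b⟩)
      simp [hab]
    rw [this, mul_zero]

variable {R : Type*} [CommRing R]
lemma hm_perm (q : Fin n → Fin n → R) (k : Fin n → R) (i : Fin n) (π : Perm (Fin n)) :
    (hm q (fun a => k (π a)) i).charpoly = (hm q k i).charpoly := by
  have : hm q (fun a => k (π a)) i =
      Matrix.reindex (Equiv.mulLeft π).symm (Equiv.mulLeft π).symm (hm q k i) := by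
    ext σ τ
    simp [hm, Matrix.diagonal_apply, Matrix.sum_apply, pm, mul_assoc]
  rw [this, Matrix.charpoly_reindex]

lemma hm_map {S : Type*} [CommRing S] (f : R →+* S) (q : Fin n → Fin n → R) (k : Fin n → R) (i : Fin n) :
    (hm q k i).map f = hm (fun a b => f (q a b)) (fun a => f (k a)) i := by
  ext σ τ
  simp [hm, Matrix.sum_apply, Matrix.diagonal_apply, pm, apply_ite f]

lemma cm_map {S : Type*} [CommRing S] (f : R →+* S) (q : Fin n → Fin n → R) (k : Fin n → R) :
    (cm q k).map f = cm (fun a b => f (q a b)) (fun a => f (k a)) := by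
  ext σ τ
  simp [cm, apply_ite f]

lemma exists_G (q : Fin n → Fin n → ℝ) (i : Fin n) (m : ℕ) :
    ∃ G : MvPolynomial (Fin n) ℝ, ∀ k : Fin n → ℝ,
      MvPolynomial.eval (fun l : Fin n => MvPolynomial.eval k (MvPolynomial.esymm (Fin n) ℝ (l + 1))) G
        = (hm q k i).charpoly.coeff m := by
  let H := hm (fun a b => (MvPolynomial.C (q a b) : MvPolynomial (Fin n) ℝ)) MvPolynomial.X i
  have hs : (H.charpoly.coeff m).IsSymmetric := by
    intro π
    have h1 := Matrix.charpoly_map H (MvPolynomial.rename π : MvPolynomial (Fin n) ℝ →ₐ[ℝ] _).toRingHom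
    have h2 := congrArg (fun p => p.coeff m) h1
    simp only [Polynomial.coeff_map] at h2
    refine Eq.trans h2.symm ?_
    rw [hm_map]
    simp only [AlgHom.toRingHom_eq_coe, RingHom.coe_coe, MvPolynomial.rename_C, MvPolynomial.rename_X]
    rw [hm_perm]
  obtain ⟨G, hG⟩ := (MvPolynomial.esymmAlgHom_fin_bijective (R := ℝ) n).2 ⟨_, hs⟩
  refine ⟨G, fun k => ?_⟩
  have hG' := congrArg (fun x => MvPolynomial.eval k x.val) hG
  simp only [MvPolynomial.esymmAlgHom_apply] at hG'
  have h3 : MvPolynomial.eval k (H.charpoly.coeff m) = (hm q k i).charpoly.coeff m := by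
    have h1 := Matrix.charpoly_map H (MvPolynomial.eval k)
    have h2 := congrArg (fun p => p.coeff m) h1
    simp only [Polynomial.coeff_map] at h2
    rw [← h2, hm_map]
    simp
  rw [← h3, ← hG']
  rw [← MvPolynomial.coe_aeval_eq_eval, ← MvPolynomial.coe_aeval_eq_eval]
  simp only [RingHom.coe_coe]
  rw [← AlgHom.comp_apply, MvPolynomial.comp_aeval]

lemma esymm_coeff (k : Fin n → ℝ) (l : Fin n) :
    MvPolynomial.eval k (MvPolynomial.esymm (Fin n) ℝ (l + 1)) =
      (-1) ^ ((l : ℕ) + 1) * (∏ a, (X - C (k a))).coeff (n - (l + 1)) := by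
  have h1 : ∀ a, X - C (k a) = X + C (- k a) := by intro a; simp [sub_eq_add_neg]
  simp_rw [h1]
  rw [Finset.prod_X_add_C_coeff _ _ (by simp)]
  have : (Finset.univ : Finset (Fin n)).card - (n - ((l : ℕ) + 1)) = l + 1 := by
    simp; omega
  rw [this, MvPolynomial.esymm, map_sum, Finset.mul_sum]
  refine Finset.sum_congr rfl fun t ht => ?_
  rw [Finset.prod_neg, (Finset.mem_powersetCard.mp ht).2, ← mul_assoc, ← mul_pow]
  simp

/-- Theorem A. -/
theorem real_of_nilpotent (z : Fin n → ℝ) (hz : Function.Injective z) (μ : Fin n → ℂ)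
    (h : (cm (fun i j => (((z i - z j)⁻¹ : ℝ) : ℂ)) μ).charpoly = X ^ n) (i : Fin n) :
    (μ i).im = 0 := by
  set q : Fin n → Fin n → ℝ := fun i j => (z i - z j)⁻¹ with hqdef
  have hq : ∀ i j, q i j = - q j i := by
    intro i j; simp only [hqdef]; rw [← inv_neg, neg_sub]
  have hq0 : ∀ i, q i i = 0 := by intro i; simp [hqdef]
  have hA : ∀ i j l, i ≠ j → j ≠ l → i ≠ l →
      q i j * q j l = q i l * q i j + q i l * q j l := by
    intro i j l h1 h2 h3
    have h1 := sub_ne_zero.mpr (hz.ne h1)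
    have h2 := sub_ne_zero.mpr (hz.ne h2)
    have h3 := sub_ne_zero.mpr (hz.ne h3)
    simp only [hqdef]
    field_simp
    ring
  choose G hG using fun m => exists_G q i m
  let S := MvPolynomial (Fin n) ℝ
  let Φ : Fin n → S := fun l => (-1) ^ ((l : ℕ) + 1) *
    (cm (fun a b => (MvPolynomial.C (q a b) : S)) MvPolynomial.X).charpoly.coeff (n - (l + 1))
  let B := Fintype.card (Perm (Fin n)) + 1
  let F : S := ∑ m ∈ Finset.range B, MvPolynomial.aeval Φ (G m) * MvPolynomial.X i ^ m
  have hΦ : ∀ {A : Type} [CommRing A] [Algebra ℝ A] (ν : Fin n → A) (l : Fin n),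
      MvPolynomial.aeval ν (Φ l) = (-1) ^ ((l : ℕ) + 1) *
        (cm (fun a b => algebraMap ℝ A (q a b)) ν).charpoly.coeff (n - (l + 1)) := by
    intro A _ _ ν l
    have h1 := Matrix.charpoly_map (cm (fun a b => (MvPolynomial.C (q a b) : S)) MvPolynomial.X)
      (MvPolynomial.aeval ν : S →ₐ[ℝ] A).toRingHom
    have h2 := congrArg (fun p => p.coeff (n - ((l : ℕ) + 1))) h1
    simp only [Polynomial.coeff_map] at h2
    rw [map_mul, map_pow, map_neg, map_one]
    congr 1
    refine Eq.trans h2.symm ?_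
    rw [cm_map]
    simp
  have hFev : ∀ {A : Type} [CommRing A] [Algebra ℝ A] (ν : Fin n → A) (k : Fin n → ℝ),
      (cm (fun a b => algebraMap ℝ A (q a b)) ν).charpoly
        = (∏ a, (X - C (k a))).map (algebraMap ℝ A) →
      MvPolynomial.aeval ν F = aeval (ν i) (hm q k i).charpoly := by
    intro A _ _ ν k hk
    have h1 : ∀ l, MvPolynomial.aeval ν (Φ l) = 
        algebraMap ℝ A (MvPolynomial.eval k (MvPolynomial.esymm (Fin n) ℝ (l + 1))) := by
      intro l
      rw [hΦ, hk, esymm_coeff, Polynomial.coeff_map]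
      simp
    have h2 : ∀ m, MvPolynomial.aeval ν (MvPolynomial.aeval Φ (G m))
        = algebraMap ℝ A ((hm q k i).charpoly.coeff m) := by
      intro m
      rw [← hG, ← AlgHom.comp_apply, MvPolynomial.comp_aeval]
      simp_rw [h1]
      have := MvPolynomial.aeval_algebraMap_apply A (fun l : Fin n =>
        MvPolynomial.eval k (MvPolynomial.esymm (Fin n) ℝ (l + 1))) (G m)
      rw [MvPolynomial.aeval_eq_eval] at this
      exact this
    rw [Polynomial.aeval_eq_sum_range' (n := B) (by
      rw [Matrix.charpoly_natDegree_eq_dim]; simp [B])]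
    simp only [F, map_sum, map_mul, map_pow, MvPolynomial.aeval_X, h2, Algebra.smul_def]
  have hF : F = 0 := by
    apply dim_aux F Φ
    intro k hk
    obtain ⟨v, ν, hv, hs⟩ := exists_eig q hq hq0 hA k
    have hch := charpoly_cm_of_eig q hq0 k hk v ν hv hs
    refine ⟨ν, ?_, ?_⟩
    · have := hFev (A := ℝ) ν k (by simpa using hch)
      rw [MvPolynomial.aeval_eq_eval] at this
      rw [this, Polynomial.coe_aeval_eq_eval]
      show IsRoot _ _
      rw [← Matrix.charpoly_toLin', ← Module.End.hasEigenvalue_iff_isRoot_charpoly]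
      apply Module.End.hasEigenvalue_of_hasEigenvector (x := v)
      rw [Module.End.hasEigenvector_iff]
      refine ⟨by rw [Module.End.mem_eigenspace_iff]; simpa using hv i, ?_⟩
      rintro rfl
      simp at hs
    · intro l
      have := hΦ (A := ℝ) ν l
      rw [MvPolynomial.aeval_eq_eval] at this
      rw [this, esymm_coeff, ← hch]
      simp
  have h1 := hFev (A := ℂ) μ (fun _ => 0) (by
    refine Eq.trans h ?_
    simp)
  rw [hF, map_zero] at h1
  have hherm : (hm q (fun _ => 0) i).IsHermitian := by
    rw [Matrix.IsHermitian, Matrix.conjTranspose_eq_transpose_of_trivial, hm_transpose]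
  rw [hherm.charpoly_eq, map_prod] at h1
  obtain ⟨a, _, ha⟩ := Finset.prod_eq_zero_iff.mp h1.symm
  simp only [map_sub, aeval_X, aeval_C] at ha
  rw [sub_eq_zero.mp ha]
  simp
end
end Gaudin

namespace Wrk
section
variable {R : Type*} [CommRing R] {d : ℕ}

/-- Wronskian over a commutative ring. -/
noncomputable def wr (f : Fin d → R[X]) : R[X] :=
  Matrix.det (Matrix.of fun i j : Fin d => derivative^[(j : ℕ)] (f i))

/-- Vandermonde-type constant. -/
def vd (R : Type*) [CommRing R] {d : ℕ} (a : Fin d → ℕ) : R :=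
  Matrix.det (Matrix.of fun i j : Fin d => (((a i).descFactorial j : ℕ) : R))

lemma vd_ne_zero [IsDomain R] [CharZero R] (a : Fin d → ℕ) (ha : Function.Injective a) :
    vd R a ≠ 0 := by
  have h := Matrix.det_eval_matrixOfPolynomials_eq_det_vandermonde (fun i => (a i : R))
    (fun i : Fin d => descPochhammer R i) (fun i => descPochhammer_natDegree R i)
    (fun i => monic_descPochhammer R i)
  have h2 : vd R a = (Matrix.vandermonde fun i => (a i : R)).det := by
    rw [h, vd]
    congr 1
    ext i j
    simp [descPochhammer_eval_eq_descFactorial]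
  rw [h2, Matrix.det_vandermonde_ne_zero_iff]
  intro i j hij
  exact ha (Nat.cast_injective hij)

lemma vd_map {S : Type*} [CommRing S] (φ : R →+* S) (a : Fin d → ℕ) : φ (vd R a) = vd S a := by
  rw [vd, vd, RingHom.map_det]
  congr 1
  ext i j
  simp

lemma coeff_X_pow_mul_iterate (p : R[X]) (j m : ℕ) :
    (X ^ j * derivative^[j] p).coeff m = (m.descFactorial j : R) * p.coeff m := by
  rw [coeff_X_pow_mul']
  split_ifs with h
  · rw [coeff_iterate_derivative, Nat.sub_add_cancel h, nsmul_eq_mul]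
  · rw [Nat.descFactorial_eq_zero_iff_lt.mpr (by omega)]; simp

lemma prod_aux {ι : Type*} (s : Finset ι) (p : ι → R[X]) (a : ι → ℕ)
    (h : ∀ i ∈ s, (p i).natDegree ≤ a i) :
    (∏ i ∈ s, p i).natDegree ≤ ∑ i ∈ s, a i ∧
    (∏ i ∈ s, p i).coeff (∑ i ∈ s, a i) = ∏ i ∈ s, (p i).coeff (a i) := by
  classical
  induction s using Finset.induction_on with
  | empty => simp
  | insert i s hi ih =>
    obtain ⟨h1, h2⟩ := ih fun j hj => h j (Finset.mem_insert_of_mem hj)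
    have h3 := h i (Finset.mem_insert_self _ _)
    rw [Finset.prod_insert hi, Finset.sum_insert hi, Finset.prod_insert hi]
    refine ⟨natDegree_mul_le_of_le h3 h1, ?_⟩
    rw [coeff_mul_add_eq_of_natDegree_le h3 h1, h2]

lemma det_aux (M : Matrix (Fin d) (Fin d) R[X]) (a : Fin d → ℕ)
    (h : ∀ i j, (M i j).natDegree ≤ a i) :
    M.det.natDegree ≤ ∑ i, a i ∧
    M.det.coeff (∑ i, a i) = (Matrix.of fun i j => (M i j).coeff (a i)).det := by
  rw [← Matrix.det_transpose M, ← Matrix.det_transpose (Matrix.of _)]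
  rw [Matrix.det_apply, Matrix.det_apply]
  constructor
  · apply natDegree_sum_le_of_forall_le
    intro σ _
    refine le_trans ?_ ((prod_aux Finset.univ (fun i => M i (σ i)) a fun i _ => h i _).1)
    rw [Units.smul_def]
    exact (natDegree_smul_le _ _)
  · rw [finsetSum_coeff]
    refine Finset.sum_congr rfl fun σ _ => ?_
    rw [Units.smul_def, Units.smul_def, coeff_smul]
    congr 1
    exact ((prod_aux Finset.univ (fun i => M i (σ i)) a fun i _ => h i _).2)

lemma X_pow_mul_wr (f : Fin d → R[X]) :
    X ^ (∑ j : Fin d, (j : ℕ)) * wr f =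
      Matrix.det (Matrix.of fun i j : Fin d => X ^ (j : ℕ) * derivative^[(j : ℕ)] (f i)) := by
  rw [← Finset.prod_pow_eq_pow_sum, wr, ← Matrix.det_mul_row]
  rfl

lemma wr_deg (f : Fin d → R[X]) (a : Fin d → ℕ) (ha : ∑ j : Fin d, (j : ℕ) ≤ ∑ i, a i)
    (h : ∀ i, (f i).natDegree ≤ a i) :
    (wr f).natDegree ≤ (∑ i, a i) - ∑ j : Fin d, (j : ℕ) ∧
    (wr f).coeff ((∑ i, a i) - ∑ j : Fin d, (j : ℕ)) = (∏ i, (f i).coeff (a i)) * vd R a := by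
  have h0 : ∀ i j : Fin d, (X ^ (j : ℕ) * derivative^[(j : ℕ)] (f i)).natDegree ≤ a i := by
    intro i j
    rw [natDegree_le_iff_coeff_eq_zero]
    intro m hm
    rw [coeff_X_pow_mul_iterate, coeff_eq_zero_of_natDegree_lt ((h i).trans_lt hm), mul_zero]
  obtain ⟨h1, h2⟩ := det_aux (Matrix.of fun i j : Fin d => X ^ (j : ℕ) * derivative^[(j : ℕ)] (f i)) a h0
  rw [← X_pow_mul_wr] at h1 h2
  constructor
  · rw [natDegree_le_iff_coeff_eq_zero] at h1 ⊢
    intro m hm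
    have := h1 (m + ∑ j : Fin d, (j : ℕ)) (by omega)
    rwa [coeff_X_pow_mul] at this
  · obtain ⟨c, hc⟩ := Nat.exists_eq_add_of_le' ha
    rw [hc, Nat.add_sub_cancel]
    rw [hc, coeff_X_pow_mul] at h2
    rw [h2, vd, ← Matrix.det_mul_column]
    congr 1
    ext i j
    simp only [Matrix.of_apply]
    rw [coeff_X_pow_mul_iterate, mul_comm]

lemma wr_map {S : Type*} [CommRing S] (φ : R →+* S) (f : Fin d → R[X]) :
    wr (fun i => (f i).map φ) = (wr f).map φ := by
  rw [wr, wr, ← coe_mapRingHom, RingHom.map_det]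
  congr 1
  ext1 i j
  simp [iterate_derivative_map]

lemma wr_lin (P : Matrix (Fin d) (Fin d) R) (f g : Fin d → R[X])
    (h : ∀ i, g i = ∑ j, C (P i j) * f j) : wr g = C P.det * wr f := by
  have : (Matrix.of fun i j : Fin d => derivative^[(j : ℕ)] (g i)) =
      P.map C * (Matrix.of fun i j : Fin d => derivative^[(j : ℕ)] (f i)) := by
    ext1 i j
    simp [h, Matrix.mul_apply, iterate_derivative_sum, iterate_derivative_C_mul]
  rw [wr, this, Matrix.det_mul, wr, RingHom.map_det]
  rfl

lemma strictMono_le (a : Fin d → ℕ) (ha : StrictMono a) : ∑ j : Fin d, (j : ℕ) ≤ ∑ i, a i := by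
  suffices H : ∀ i : Fin d, (i : ℕ) ≤ a i from Finset.sum_le_sum fun i _ => H i
  rintro ⟨i, hi⟩
  induction i with
  | zero => simp
  | succ i ih =>
    have h1 := ih (by omega)
    have h2 : a ⟨i, by omega⟩ < a ⟨i + 1, hi⟩ := ha (by simp)
    simp only at h1 h2 ⊢
    omega

end
section field
variable {K : Type*} [Field K] {d : ℕ}

lemma exists_reduced (m : ℕ) : ∀ V : Submodule K K[X], V ≤ degreeLT K m →
    ∃ (S : Finset ℕ) (f : ℕ → K[X]), (∀ s ∈ S, s < m) ∧ (∀ s ∈ S, (f s).Monic ∧ (f s).natDegree = s) ∧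
      (∀ s ∈ S, ∀ t ∈ S, (f s).coeff t = if s = t then 1 else 0) ∧
      Submodule.span K (f '' S) = V := by
  induction m with
  | zero =>
    intro V hV
    refine ⟨∅, 0, by simp, by simp, by simp, ?_⟩
    have : degreeLT K 0 = ⊥ := by
      rw [eq_bot_iff]; intro p hp
      rw [mem_degreeLT] at hp
      simpa using hp
    rw [this] at hV
    simpa using (le_bot_iff.mp hV).symm
  | succ m ih =>
    intro V hV
    by_cases hVm : V ≤ degreeLT K m
    · obtain ⟨S, f, h1, h2, h3, h4⟩ := ih V hVm
      exact ⟨S, f, fun s hs => (h1 s hs).trans (Nat.lt_succ_self _), h2, h3, h4⟩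
    · obtain ⟨S, f, h1, h2, h3, h4⟩ := ih (V ⊓ degreeLT K m) inf_le_right
      obtain ⟨p0, hp0V, hp0⟩ := SetLike.not_le_iff_exists.mp hVm
      have hcm : p0.coeff m ≠ 0 := by
        intro h0
        apply hp0
        have hlt := hV hp0V
        rw [mem_degreeLT] at hlt ⊢
        rw [degree_lt_iff_coeff_zero] at hlt ⊢
        intro k hk
        rcases Nat.eq_or_lt_of_le hk with rfl | hk
        · exact h0
        · exact hlt k hk
      have hfV : ∀ s ∈ S, f s ∈ V := fun s hs =>
        (h4.le (Submodule.subset_span ⟨s, hs, rfl⟩)).1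
      set p := C (p0.coeff m)⁻¹ * p0 with hp
      have hpV : p ∈ V := by
        rw [hp, ← smul_eq_C_mul]; exact V.smul_mem _ hp0V
      have hpm : p.coeff m = 1 := by rw [hp, coeff_C_mul, inv_mul_cancel₀ hcm]
      clear_value p
      set g := p - ∑ s ∈ S, C (p.coeff s) * f s with hg
      have hgV : g ∈ V := by
        refine V.sub_mem hpV (V.sum_mem fun s hs => ?_)
        rw [← smul_eq_C_mul]; exact V.smul_mem _ (hfV s hs)
      have hfm : ∀ s ∈ S, (f s).coeff m = 0 := fun s hs =>
        coeff_eq_zero_of_natDegree_lt (by rw [(h2 s hs).2]; exact h1 s hs)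
      have hgm : g.coeff m = 1 := by
        rw [hg, coeff_sub, hpm, finsetSum_coeff, Finset.sum_eq_zero, sub_zero]
        intro s hs
        rw [coeff_C_mul, hfm s hs, mul_zero]
      have hgS : ∀ t ∈ S, g.coeff t = 0 := by
        intro t ht
        rw [hg, coeff_sub, finsetSum_coeff, Finset.sum_eq_single t]
        · rw [coeff_C_mul, h3 t ht t ht]; simp
        · intro s hs hst
          rw [coeff_C_mul, h3 s hs t ht]; simp [hst]
        · exact fun h => absurd ht h
      have hgd : g.natDegree ≤ m := by
        have := hV hgV
        rw [mem_degreeLT, degree_lt_iff_coeff_zero] at this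
        rw [natDegree_le_iff_coeff_eq_zero]
        intro k hk; exact this k hk
      have hmS : m ∉ S := fun h => lt_irrefl _ (h1 m h)
      have hup : ∀ s ∈ S, Function.update f m g s = f s := fun s hs =>
        Function.update_of_ne (fun h : s = m => hmS (h ▸ hs)) _ _
      refine ⟨insert m S, Function.update f m g, ?_, ?_, ?_, ?_⟩
      · intro s hs
        rcases Finset.mem_insert.mp hs with rfl | hs
        · exact Nat.lt_succ_self _
        · exact (h1 s hs).trans (Nat.lt_succ_self _)
      · intro s hs
        rcases Finset.mem_insert.mp hs with rfl | hs
        · rw [Function.update_self]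
          refine ⟨monic_of_natDegree_le_of_coeff_eq_one _ hgd hgm, le_antisymm hgd ?_⟩
          exact le_natDegree_of_ne_zero (by rw [hgm]; exact one_ne_zero)
        · rw [hup s hs]; exact h2 s hs
      · intro s hs t ht
        rcases Finset.mem_insert.mp hs with rfl | hs
        · rw [Function.update_self]
          rcases Finset.mem_insert.mp ht with rfl | ht
          · simp [hgm]
          · rw [hgS t ht, if_neg]; rintro rfl; exact hmS ht
        · rw [hup s hs]
          rcases Finset.mem_insert.mp ht with rfl | ht
          · rw [hfm s (by assumption), if_neg]; rintro rfl; exact hmS (by assumption)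
          · exact h3 s hs t ht
      · have him : Function.update f m g '' (insert m S : Finset ℕ) = insert g (f '' S) := by
          rw [Finset.coe_insert, Set.image_insert_eq, Function.update_self]
          congr 1
          exact Set.image_congr fun s hs => hup s hs
        rw [him, Submodule.span_insert, h4]
        apply le_antisymm
        · refine sup_le ?_ inf_le_left
          rw [Submodule.span_singleton_le_iff_mem]; exact hgV
        · intro v hv
          have : v = C (v.coeff m) * g + (v - C (v.coeff m) * g) := by ring
          rw [this]
          have hgv : C (v.coeff m) * g ∈ V := by
            rw [← smul_eq_C_mul]; exact V.smul_mem _ hgV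
          refine Submodule.add_mem_sup ?_ ⟨V.sub_mem hv hgv, ?_⟩
          · rw [← smul_eq_C_mul]; exact Submodule.smul_mem _ _ (Submodule.mem_span_singleton_self _)
          · have h5 := hV (V.sub_mem hv hgv)
            rw [mem_degreeLT, degree_lt_iff_coeff_zero] at h5
            show _ ∈ degreeLT K m
            rw [mem_degreeLT, degree_lt_iff_coeff_zero]
            intro k hk
            rcases Nat.eq_or_lt_of_le hk with rfl | hk
            · rw [coeff_sub, coeff_C_mul, hgm]; simp
            · exact h5 k hk

lemma exists_reduced_basis (f : Fin d → K[X]) (hf : LinearIndependent K f) :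
    ∃ (a : Fin d → ℕ) (g : Fin d → K[X]), StrictMono a ∧ (∀ i, (g i).Monic) ∧
      (∀ i, (g i).natDegree = a i) ∧ (∀ i j, (g i).coeff (a j) = if i = j then 1 else 0) ∧
      LinearIndependent K g ∧ Submodule.span K (Set.range g) = Submodule.span K (Set.range f) := by
  obtain ⟨m, hm⟩ : ∃ m, Submodule.span K (Set.range f) ≤ degreeLT K m := by
    refine ⟨(Finset.univ.sup fun i => (f i).natDegree) + 1, ?_⟩
    rw [Submodule.span_le]
    rintro _ ⟨i, rfl⟩
    rw [SetLike.mem_coe, mem_degreeLT]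
    refine lt_of_le_of_lt degree_le_natDegree ?_
    have := Finset.le_sup (f := fun i => (f i).natDegree) (Finset.mem_univ i)
    exact_mod_cast Nat.lt_succ_of_le this
  obtain ⟨S, F, h1, h2, h3, h4⟩ := exists_reduced m _ hm
  have hli : LinearIndependent K (fun s : S => F s) := by
    rw [Fintype.linearIndependent_iff]
    intro c hc t
    have := congrArg (fun p => p.coeff t) hc
    simp only [finsetSum_coeff, coeff_smul, coeff_zero] at this
    rw [Finset.sum_eq_single t] at this
    · simpa [h3 t t.2 t t.2] using this
    · intro s _ hst
      rw [h3 s s.2 t t.2, if_neg (fun h => hst (Subtype.ext h))]; simp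
    · simp
  have hr : Set.range (fun s : S => F s) = F '' S := by
    ext; simp
  have hcard : S.card = d := by
    have e1 := finrank_span_eq_card hli
    have e2 := finrank_span_eq_card hf
    rw [hr, h4, e2] at e1
    simpa using e1.symm
  let a := S.orderEmbOfFin hcard
  have haS : ∀ i, a i ∈ S := fun i => S.orderEmbOfFin_mem hcard i
  refine ⟨a, fun i => F (a i), a.strictMono, fun i => (h2 _ (haS i)).1, fun i => (h2 _ (haS i)).2,
    ?_, ?_, ?_⟩
  · intro i j
    rw [h3 _ (haS i) _ (haS j)]
    simp
  · exact hli.comp (fun i => (⟨a i, haS i⟩ : S)) fun i j h => a.injective (by simpa using h)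
  · rw [← h4]
    congr 1
    have : Set.range (fun i => F (a i)) = F '' (Set.range a) := by
      ext; simp
    rw [this, Finset.range_orderEmbOfFin]

lemma wr_reduced [CharZero K] (g : Fin d → K[X]) (a : Fin d → ℕ) (ha : StrictMono a)
    (h1 : ∀ i, (g i).Monic) (h2 : ∀ i, (g i).natDegree = a i) :
    (wr g).natDegree = (∑ i, a i) - ∑ j : Fin d, (j : ℕ) ∧ (wr g).leadingCoeff = vd K a ∧ wr g ≠ 0 := by
  obtain ⟨e1, e2⟩ := wr_deg g a (strictMono_le a ha) (fun i => (h2 i).le)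
  have e3 : ∏ i, (g i).coeff (a i) = 1 := Finset.prod_eq_one fun i _ => by
    rw [← h2]; exact h1 i
  rw [e3, one_mul] at e2
  have hv := vd_ne_zero (R := K) a ha.injective
  have e4 : (wr g).natDegree = (∑ i, a i) - ∑ j : Fin d, (j : ℕ) :=
    le_antisymm e1 (le_natDegree_of_ne_zero (by rw [e2]; exact hv))
  refine ⟨e4, ?_, ?_⟩
  · rw [leadingCoeff, e4, e2]
  · intro h; rw [h] at e2; exact hv (by simpa using e2.symm)

lemma wr_of_mem_span (f g : Fin d → K[X]) (h : ∀ i, g i ∈ Submodule.span K (Set.range f)) :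
    ∃ c : K, wr g = C c * wr f := by
  have : ∀ i, ∃ c : Fin d → K, ∑ j, c j • f j = g i := fun i =>
    (Submodule.mem_span_range_iff_exists_fun K).mp (h i)
  choose P hP using this
  refine ⟨_, wr_lin (Matrix.of P) f g fun i => ?_⟩
  rw [← hP]
  simp [smul_eq_C_mul]

lemma wr_ne_zero [CharZero K] (f : Fin d → K[X]) (hf : LinearIndependent K f) : wr f ≠ 0 := by
  obtain ⟨a, g, ha, h1, h2, h3, h4, h5⟩ := exists_reduced_basis f hf
  obtain ⟨c, hc⟩ := wr_of_mem_span f g fun i => h5.le (Submodule.subset_span ⟨i, rfl⟩)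
  intro h
  apply (wr_reduced g a ha h1 h2).2.2
  rw [hc, h, mul_zero]

end field
end Wrk

namespace Gaudin
open scoped Matrix
section
variable {n : ℕ}

lemma cm_nilp (z : Fin n → ℂ) (hz : Function.Injective z) (μ : Fin n → ℂ) (d : ℕ)
    (h : (cm (fun i j => (z i - z j)⁻¹) μ) ^ d *ᵥ (fun _ => 1) = 0) :
    (cm (fun i j => (z i - z j)⁻¹) μ).charpoly = X ^ n := by
  set M := cm (fun i j => (z i - z j)⁻¹) μ with hM
  have hcomm : Matrix.diagonal z * M - M * Matrix.diagonal z
      = 1 - Matrix.of (fun _ _ => 1) := by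
    ext i j
    rw [Matrix.sub_apply, Matrix.diagonal_mul, Matrix.mul_diagonal, Matrix.sub_apply, Matrix.one_apply]
    simp only [hM, cm, Matrix.of_apply]
    split_ifs with hij
    · subst hij; ring
    · have := sub_ne_zero.mpr (hz.ne hij)
      field_simp
      ring
  obtain ⟨g, hg, hgd⟩ := Polynomial.exists_eq_pow_rootMultiplicity_mul_and_not_dvd M.charpoly
    (Matrix.charpoly_monic M).ne_zero 0
  set m := rootMultiplicity 0 M.charpoly
  rw [C_0, sub_zero] at hg hgd
  have hcop : IsCoprime (X ^ (m + d)) g :=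
    IsCoprime.pow_left ((Polynomial.irreducible_X.coprime_iff_not_dvd).mpr hgd)
  obtain ⟨u, v, huv⟩ := hcop
  set e := aeval M (u * X ^ (m + d)) with he
  have hp0 : aeval M (X ^ m * g) = 0 := by rw [← hg]; exact Matrix.aeval_self_charpoly M
  have hidem : e * e = e := by
    have : (u * X ^ (m + d)) * (u * X ^ (m + d)) = u * X ^ (m + d) - u * X ^ d * v * (X ^ m * g) := by
      linear_combination (u * X ^ (m + d)) * huv
    rw [he, ← map_mul, this, map_sub, map_mul _ _ (X ^ m * g), hp0, mul_zero, sub_zero]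
  have heM : e * M = M * e := by
    have : M = aeval M (X : ℂ[X]) := by simp
    rw [he]
    conv_lhs => rw [this]
    conv_rhs => rw [this]
    simp only [aeval_X]
    conv_lhs => enter [2]; rw [this]
    conv_rhs => enter [1]; rw [this]
    rw [← map_mul, ← map_mul, mul_comm]
  have he1 : e *ᵥ (fun _ => 1) = 0 := by
    rw [he, map_mul, map_pow, aeval_X, pow_add, ← mul_assoc, ← Matrix.mulVec_mulVec, h, Matrix.mulVec_zero]
  have htr : e.trace = 0 := by
    have h1 : (e * (Matrix.diagonal z * M - M * Matrix.diagonal z)).trace = 0 := by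
      rw [mul_sub, Matrix.trace_sub, ← mul_assoc, Matrix.trace_mul_comm, ← mul_assoc, ← mul_assoc, heM,
        sub_self]
    rw [hcomm, mul_sub, mul_one, Matrix.trace_sub] at h1
    have h2 : e * Matrix.of (fun _ _ => 1) = 0 := by
      ext i j
      have := congrFun he1 i
      simpa [Matrix.mul_apply, Matrix.mulVec, dotProduct] using this
    rw [h2] at h1
    simpa using h1
  have he0 : e = 0 := by
    have hi : IsIdempotentElem (Matrix.toLin' e) := by
      show Matrix.toLin' e * Matrix.toLin' e = _
      rw [Module.End.mul_eq_comp, ← Matrix.toLin'_mul, hidem]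
    have := LinearMap.IsIdempotentElem.eq_zero_of_trace_eq_zero hi (by
      rw [Matrix.trace_toLin'_eq, htr])
    simpa using this
  have hg1 : aeval M (v * g) = 1 := by
    have := congrArg (aeval M) huv
    rw [map_add, ← he, he0, zero_add, map_one] at this
    exact this
  have hnil : M ^ m = 0 := by
    have : aeval M (X ^ m * (v * g)) = 0 := by
      rw [show X ^ m * (v * g) = v * (X ^ m * g) by ring, map_mul, hp0, mul_zero]
    rw [map_mul, hg1, mul_one, map_pow, aeval_X] at this
    exact this
  have hnl : IsNilpotent (Matrix.toLin' M) := ⟨m, by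
    rw [← Matrix.toLin'_pow, hnil, map_zero]⟩
  have := hnl.charpoly_eq_X_pow_finrank
  rw [Matrix.charpoly_toLin'] at this
  simpa using this
end
end Gaudin

namespace Wrk
section
variable {R : Type*} [CommRing R] {d : ℕ}

lemma derivative_det {m : Type*} [Fintype m] [DecidableEq m] (A : Matrix m m R[X]) :
    derivative A.det = ∑ j, (A.updateCol j (fun i => derivative (A i j))).det := by
  simp_rw [Matrix.det_apply]
  rw [derivative_sum, Finset.sum_comm]
  refine Finset.sum_congr rfl fun σ _ => ?_
  rw [Units.smul_def, derivative_smul, derivative_prod_finset, Finset.smul_sum]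
  refine Finset.sum_congr rfl fun j _ => ?_
  rw [Units.smul_def]
  congr 1
  rw [← Finset.mul_prod_erase _ _ (Finset.mem_univ j), Matrix.updateCol_self, mul_comm]
  congr 1
  refine Finset.prod_congr rfl fun i hi => ?_
  rw [Matrix.updateCol_ne (Finset.ne_of_mem_erase hi)]

/-- Coefficients of the monic-type differential operator annihilating the span of `f`. -/
noncomputable def bk (f : Fin d → R[X]) (k : Fin (d + 1)) : R[X] :=
  (-1) ^ (d + (k : ℕ)) * Matrix.det (Matrix.of fun i j : Fin d => derivative^[(k.succAbove j : ℕ)] (f i))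

lemma wr_snoc (f : Fin d → R[X]) (g : R[X]) :
    wr (Fin.snoc f g : Fin (d + 1) → R[X]) = ∑ k : Fin (d + 1), bk f k * derivative^[(k : ℕ)] g := by
  rw [wr, Matrix.det_succ_row _ (Fin.last d)]
  refine Finset.sum_congr rfl fun k _ => ?_
  simp only [bk, Matrix.of_apply, Fin.snoc_last, Fin.val_last]
  rw [mul_right_comm]
  congr 3
  ext1 i j
  simp

lemma bk_annih (f : Fin d → R[X]) (i : Fin d) :
    ∑ k : Fin (d + 1), bk f k * derivative^[(k : ℕ)] (f i) = 0 := by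
  rw [← wr_snoc, wr]
  apply Matrix.det_zero_of_row_eq (i := i.castSucc) (j := Fin.last d) (Fin.castSucc_lt_last i).ne
  ext1 j
  simp

lemma bk_last (f : Fin d → R[X]) : bk f (Fin.last d) = wr f := by
  rw [bk, Fin.val_last, ← two_mul, pow_mul]
  simp [wr]

lemma bk_pred (f : Fin (d + 1) → R[X]) : bk f (Fin.last d).castSucc = - derivative (wr f) := by
  rw [wr, derivative_det, Finset.sum_eq_single (Fin.last d)]
  · rw [bk, Fin.val_castSucc, Fin.val_last, show d + 1 + d = 2 * d + 1 by ring, pow_succ, pow_mul]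
    simp only [neg_one_sq, one_pow, one_mul, neg_mul]
    congr 2
    ext1 i j
    refine Fin.lastCases ?_ (fun j => ?_) j
    · simp only [Matrix.updateCol_self, Matrix.of_apply]
      rw [← Function.iterate_succ_apply' (⇑derivative)]
      have hj : (((Fin.last d).castSucc.succAbove (Fin.last d) : Fin (d + 2)) : ℕ) = d + 1 := by
        simp [Fin.succAbove]
      rw [hj, Fin.val_last]
    · rw [Matrix.updateCol_ne (Fin.castSucc_lt_last j).ne]
      simp only [Matrix.of_apply]
      have hj : (((Fin.last d).castSucc.succAbove j.castSucc : Fin (d + 2)) : ℕ) = j := by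
        rw [Fin.succAbove_of_castSucc_lt]
        · simp
        · exact Fin.castSucc_lt_castSucc_iff.mpr (Fin.castSucc_lt_last j)
      rw [hj, Fin.val_castSucc]
  · intro j _ hj
    obtain ⟨j', rfl⟩ := Fin.exists_castSucc_eq.mpr hj
    have hne : j'.castSucc ≠ j'.succ := (Fin.castSucc_lt_succ (i := j')).ne
    apply Matrix.det_zero_of_column_eq hne
    intro i
    rw [Matrix.updateCol_self, Matrix.updateCol_ne hne.symm]
    simp only [Matrix.of_apply, Fin.val_succ, Fin.val_castSucc]
    rw [Function.iterate_succ_apply']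
  · simp

lemma det_deg (f : Fin d → R[X]) (a : Fin d → ℕ) (h : ∀ i, (f i).natDegree ≤ a i) (e : Fin d → ℕ)
    (m : ℕ) (hm : (∑ i, a i) < m + ∑ j : Fin d, e j) :
    (Matrix.det (Matrix.of fun i j : Fin d => derivative^[e j] (f i))).coeff m = 0 := by
  have h0 : ∀ i j : Fin d, (X ^ (e j) * derivative^[e j] (f i)).natDegree ≤ a i := by
    intro i j
    rw [natDegree_le_iff_coeff_eq_zero]
    intro m hm
    rw [coeff_X_pow_mul_iterate, coeff_eq_zero_of_natDegree_lt ((h i).trans_lt hm), mul_zero]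
  obtain ⟨h1, -⟩ := det_aux (Matrix.of fun i j : Fin d =>
    X ^ (e j) * derivative^[e j] (f i)) a h0
  have h2 : Matrix.det (Matrix.of fun i j : Fin d =>
    X ^ (e j) * derivative^[e j] (f i)) =
      X ^ (∑ j : Fin d, e j) *
        Matrix.det (Matrix.of fun i j : Fin d => derivative^[e j] (f i)) := by
    rw [← Finset.prod_pow_eq_pow_sum, ← Matrix.det_mul_row]
    rfl
  rw [h2, natDegree_le_iff_coeff_eq_zero] at h1
  have h3 := h1 _ hm
  rwa [coeff_X_pow_mul] at h3

lemma bk_deg (f : Fin d → R[X]) (a : Fin d → ℕ) (h : ∀ i, (f i).natDegree ≤ a i) (k : Fin (d + 1))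
    (m : ℕ) (hm : (∑ i, a i) < m + ∑ j : Fin d, (k.succAbove j : ℕ)) : (bk f k).coeff m = 0 := by
  have h3 := det_deg f a h (fun j => (k.succAbove j : ℕ)) m hm
  have h4 : (-1 : R[X]) ^ (d + (k : ℕ)) = C ((-1) ^ (d + (k : ℕ))) := by simp
  rw [bk, h4, coeff_C_mul, h3, mul_zero]

lemma sum_succAbove (k : Fin (d + 1)) :
    (∑ j : Fin d, (k.succAbove j : ℕ)) + k = (∑ j : Fin d, (j : ℕ)) + d := by
  have h1 := Fin.sum_univ_succAbove (fun j : Fin (d + 1) => (j : ℕ)) k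
  have h2 := Fin.sum_univ_castSucc (fun j : Fin (d + 1) => (j : ℕ))
  simp only [Fin.val_castSucc, Fin.val_last] at h2
  omega

lemma bk_deg_lt (f : Fin d → R[X]) (a : Fin d → ℕ) (h : ∀ i, (f i).natDegree ≤ a i) (k : Fin d) 
    (ha : ∑ j : Fin d, (j : ℕ) ≤ ∑ i, a i) :
    (bk f k.castSucc).degree < (((∑ i, a i) - ∑ j : Fin d, (j : ℕ) : ℕ) : WithBot ℕ) := by
  rw [degree_lt_iff_coeff_zero]
  intro m hm
  apply bk_deg f a h
  have := sum_succAbove k.castSucc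
  rw [Fin.val_castSucc] at this
  have := k.2
  omega

end
section field
variable {K : Type*} [Field K] [CharZero K] {d : ℕ}

lemma mem_span_of_annih (f : Fin d → K[X]) (hf : LinearIndependent K f) (g : K[X])
    (h : ∑ k : Fin (d + 1), bk f k * derivative^[(k : ℕ)] g = 0) :
    g ∈ Submodule.span K (Set.range f) := by
  by_contra hg
  have := hf.finSnoc hg
  exact wr_ne_zero _ this (by rw [wr_snoc, h])
end field
end Wrk

namespace Wrk
section
variable {n : ℕ}

/-- Product of `X - z j` over `j ≠ i`. -/
noncomputable def wi (z : Fin n → ℂ) (i : Fin n) : ℂ[X] := ∏ j ∈ Finset.univ.erase i, (X - C (z j))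

lemma wi_mul (z : Fin n → ℂ) (i : Fin n) : (X - C (z i)) * wi z i = ∏ j, (X - C (z j)) := by
  rw [wi, Finset.mul_prod_erase _ (fun j => X - C (z j)) (Finset.mem_univ i)]

lemma wi_eval_self (z : Fin n → ℂ) (hz : Function.Injective z) (i : Fin n) : (wi z i).eval (z i) ≠ 0 := by
  rw [wi, eval_prod, Finset.prod_ne_zero_iff]
  intro j hj
  simp only [eval_sub, eval_X, eval_C]
  exact sub_ne_zero.mpr fun h => (Finset.ne_of_mem_erase hj) (hz h).symm

lemma wi_eval_ne (z : Fin n → ℂ) (i j : Fin n) (hij : i ≠ j) : (wi z j).eval (z i) = 0 := by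
  rw [wi, eval_prod]
  apply Finset.prod_eq_zero (Finset.mem_erase.mpr ⟨hij, Finset.mem_univ i⟩)
  simp

lemma deriv_prod_eval (z : Fin n → ℂ) (i : Fin n) :
    (derivative (∏ j, (X - C (z j)))).eval (z i) = (wi z i).eval (z i) := by
  rw [← wi_mul z i]
  simp

lemma wi_deriv_ne (z : Fin n → ℂ) (hz : Function.Injective z) (i j : Fin n) (hij : i ≠ j) :
    (derivative (wi z j)).eval (z i) = (z i - z j)⁻¹ * (wi z i).eval (z i) := by
  have h := deriv_prod_eval z i
  rw [← wi_mul z j] at h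
  simp only [derivative_mul, derivative_sub, derivative_X, derivative_C, sub_zero, one_mul, eval_add,
    eval_mul, eval_sub, eval_X, eval_C] at h
  rw [wi_eval_ne z i j hij, zero_add] at h
  rw [← h, inv_mul_cancel_left₀]
  exact sub_ne_zero.mpr fun h => hij (hz h)

lemma wi_deriv_self (z : Fin n → ℂ) (hz : Function.Injective z) (i : Fin n) :
    (derivative (wi z i)).eval (z i) = (∑ l, (z i - z l)⁻¹) * (wi z i).eval (z i) := by
  conv_lhs => rw [wi]
  rw [derivative_prod_finset, eval_finsetSum, ← Finset.add_sum_erase _ _ (Finset.mem_univ i)]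
  simp only [sub_self, inv_zero, zero_add]
  rw [Finset.sum_mul]
  refine Finset.sum_congr rfl fun l hl => ?_
  have hne : z i - z l ≠ 0 := sub_ne_zero.mpr fun h => (Finset.ne_of_mem_erase hl) (hz h).symm
  rw [wi, ← Finset.mul_prod_erase _ _ hl]
  simp only [eval_mul, eval_sub, eval_X, eval_C, derivative_sub, derivative_X, derivative_C, sub_zero, eval_one, mul_one]
  rw [inv_mul_cancel_left₀ hne]

lemma wi_degree (z : Fin n → ℂ) (i : Fin n) : (wi z i).degree < n := by
  rw [wi, degree_prod]
  have : 0 < n := i.pos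
  simp only [degree_X_sub_C, Finset.sum_const, Finset.card_erase_of_mem (Finset.mem_univ i), Finset.card_univ, Fintype.card_fin]
  simp only [nsmul_eq_mul, mul_one]
  exact_mod_cast Nat.sub_lt this one_pos

lemma lag (z : Fin n → ℂ) (hz : Function.Injective z) (p : ℂ[X]) (hp : p.degree < n) :
    p = ∑ i, C (p.eval (z i) / (wi z i).eval (z i)) * wi z i := by
  apply Polynomial.eq_of_degrees_lt_of_eval_index_eq (s := Finset.univ) (v := z) hz.injOn
  · simpa using hp
  · refine lt_of_le_of_lt (degree_sum_le _ _) ?_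
    rw [Finset.sup_lt_iff (by simp)]
    intro i _
    rw [← smul_eq_C_mul]
    refine lt_of_le_of_lt (degree_smul_le _ _) ?_
    simpa using wi_degree z i
  · intro i _
    rw [eval_finsetSum, Finset.sum_eq_single i]
    · rw [eval_mul, eval_C, div_mul_cancel₀ _ (wi_eval_self z hz i)]
    · intro j _ hj
      rw [eval_mul, wi_eval_ne z i j hj.symm, mul_zero]
    · simp

lemma lag_deriv (z : Fin n → ℂ) (hz : Function.Injective z) (p : ℂ[X]) (hp : p.degree < n) (i : Fin n) :
    (derivative p).eval (z i) / (wi z i).eval (z i) =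
      (∑ j, (z i - z j)⁻¹ * (p.eval (z j) / (wi z j).eval (z j))) +
      (∑ j, (z i - z j)⁻¹) * (p.eval (z i) / (wi z i).eval (z i)) := by
  have h := congrArg (fun q => (derivative q).eval (z i)) (lag z hz p hp)
  rw [h, derivative_sum, eval_finsetSum]
  rw [div_eq_iff (wi_eval_self z hz i), add_mul, Finset.sum_mul,
    ← Finset.add_sum_erase _ _ (Finset.mem_univ i), add_comm]
  conv_rhs => rw [← Finset.add_sum_erase _ _ (Finset.mem_univ i)]
  simp only [sub_self, inv_zero, zero_mul, zero_add]
  congr 1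
  · refine Finset.sum_congr rfl fun j hj => ?_
    rw [derivative_C_mul, eval_mul, eval_C, wi_deriv_ne z hz i j (Finset.ne_of_mem_erase hj).symm]
    ring
  · rw [derivative_C_mul, eval_mul, eval_C, wi_deriv_self z hz]
    ring

open Matrix in
lemma real_seq (t : Fin n → ℝ) (ht : Function.Injective t) (p : ℕ → ℂ[X]) (γ : Fin n → ℂ) (d : ℕ)
    (z : Fin n → ℂ) (hzt : ∀ i, z i = t i)
    (hdeg : ∀ m, (p m).degree < n) (h0 : ∀ i, (p 0).eval (z i) = - (wi z i).eval (z i))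
    (hd : p d = 0)
    (hrec : ∀ m < d, ∀ i, (derivative (p m)).eval (z i) + (p (m + 1)).eval (z i) = γ i * (p m).eval (z i)) :
    ∀ m ≤ d, (p m).map (starRingEnd ℂ) = p m := by
  have hz : Function.Injective z := by
    intro i j hij
    rw [hzt, hzt] at hij
    exact ht (Complex.ofReal_injective hij)
  set r : ℕ → Fin n → ℂ := fun m i => (p m).eval (z i) / (wi z i).eval (z i) with hr
  set μ : Fin n → ℂ := fun i => γ i - ∑ j, (z i - z j)⁻¹ with hμ
  set M := Gaudin.cm (fun i j => (z i - z j)⁻¹) μ with hM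
  have hMv : ∀ v : Fin n → ℂ, ∀ i, (M *ᵥ v) i = μ i * v i - ∑ j, (z i - z j)⁻¹ * v j := by
    intro v i
    simp only [hM, Gaudin.cm, Matrix.mulVec, dotProduct, Matrix.of_apply]
    rw [← Finset.add_sum_erase _ _ (Finset.mem_univ i), ← Finset.add_sum_erase _ (fun j => (z i - z j)⁻¹ * v j) (Finset.mem_univ i)]
    simp only [if_true, sub_self, _root_.inv_zero, zero_mul, zero_add]
    rw [sub_eq_add_neg, ← Finset.sum_neg_distrib]
    congr 1
    refine Finset.sum_congr rfl fun j hj => ?_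
    rw [if_neg (Finset.ne_of_mem_erase hj).symm]
    ring
  have hstep : ∀ m < d, r (m + 1) = M *ᵥ r m := by
    intro m hm
    ext i
    rw [hMv]
    have h1 := lag_deriv z hz (p m) (hdeg m) i
    have h2 : r (m + 1) i = γ i * r m i - (derivative (p m)).eval (z i) / (wi z i).eval (z i) := by
      simp only [hr]
      rw [eq_sub_iff_add_eq'.mpr (hrec m hm i)]
      ring
    rw [h2, h1]
    simp only [hμ, hr]
    ring
  have hr0 : r 0 = fun _ => -1 := by
    ext i
    simp only [hr, h0]
    rw [neg_div, div_self (wi_eval_self z hz i)]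
  have hpow : ∀ m ≤ d, r m = M ^ m *ᵥ (fun _ => -1) := by
    intro m
    induction m with
    | zero => intro _; simp [hr0]
    | succ m ih =>
      intro hm
      rw [hstep m (by omega), ih (by omega), Matrix.mulVec_mulVec, pow_succ']
  have hnil : M ^ d *ᵥ (fun _ => (1 : ℂ)) = 0 := by
    have h1 := hpow d le_rfl
    have h2 : r d = 0 := by ext i; simp [hr, hd]
    rw [h2] at h1
    have h3 : (fun _ : Fin n => (-1 : ℂ)) = - (fun _ => (1 : ℂ)) := by ext; simp
    rw [h3, Matrix.mulVec_neg] at h1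
    exact neg_eq_zero.mp h1.symm
  have hch := Gaudin.cm_nilp z hz μ d hnil
  have hμr : ∀ i, (μ i).im = 0 := by
    apply Gaudin.real_of_nilpotent t ht μ
    have : (fun i j => (((t i - t j)⁻¹ : ℝ) : ℂ)) = fun i j => (z i - z j)⁻¹ := by
      ext i j
      rw [hzt, hzt]; push_cast; rfl
    rw [this]
    exact hch
  have hzc : ∀ i, (starRingEnd ℂ) (z i) = z i := fun i => by rw [hzt, Complex.conj_ofReal]
  have hμc : ∀ i, (starRingEnd ℂ) (μ i) = μ i := fun i => Complex.conj_eq_iff_im.mpr (hμr i)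
  have hrc : ∀ m ≤ d, ∀ i, (starRingEnd ℂ) (r m i) = r m i := by
    intro m
    induction m with
    | zero => intro _ i; simp [hr0]
    | succ m ih =>
      intro hm i
      rw [hstep m (by omega), hMv, map_sub, map_mul, map_sum, hμc, ih (by omega)]
      congr 1
      refine Finset.sum_congr rfl fun j _ => ?_
      rw [map_mul, map_inv₀, map_sub, hzc, hzc, ih (by omega)]
  intro m hm
  rw [lag z hz (p m) (hdeg m), Polynomial.map_sum]
  refine Finset.sum_congr rfl fun i _ => ?_
  rw [Polynomial.map_mul, map_C]
  have := hrc m hm i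
  simp only [hr] at this
  rw [this]
  congr 1
  rw [wi, Polynomial.map_prod]
  refine Finset.prod_congr rfl fun j _ => ?_
  simp [hzc]

end
section
variable {e : ℕ}

/-- Shifted coefficients. -/
noncomputable def bs (f : Fin (e + 1) → ℂ[X]) : Fin (e + 2) → ℂ[X] := Fin.cons 0 (fun k => bk f k.castSucc)

lemma bk_annih' (f : Fin (e + 1) → ℂ[X]) (i : Fin (e + 1)) :
    ∑ k : Fin (e + 2), (derivative (bk f k) + bs f k) * derivative^[(k : ℕ)] (f i)
      + wr f * derivative^[e + 2] (f i) = 0 := by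
  have h := congrArg derivative (bk_annih f i)
  rw [derivative_sum, derivative_zero] at h
  simp only [derivative_mul, ← Function.iterate_succ_apply' (⇑derivative)] at h
  rw [Finset.sum_add_distrib, Fin.sum_univ_castSucc (fun k : Fin (e + 1 + 1) => bk f k * _), bk_last] at h
  simp only [add_mul]
  rw [Finset.sum_add_distrib, Fin.sum_univ_succ (fun k : Fin (e + 2) => bs f k * _)]
  simp only [bs, Fin.cons_zero, zero_mul, zero_add, Fin.cons_succ, Fin.val_succ]
  rw [← h]
  simp only [Fin.val_castSucc, Fin.val_last]
  ring

open Matrix in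
lemma local_gamma (f : Fin (e + 1) → ℂ[X]) (z : ℂ) (hz : (wr f).eval z = 0)
    (hz' : (derivative (wr f)).eval z ≠ 0) :
    ∃ γ : ℂ, ∀ k : Fin (e + 2), (derivative (bk f k)).eval z + (bs f k).eval z = γ * (bk f k).eval z := by
  set k0 : Fin (e + 2) := (Fin.last e).castSucc with hk0
  have hP0 : (bk f k0).eval z ≠ 0 := by
    rw [bk_pred, eval_neg]; exact neg_ne_zero.mpr hz'
  set Q : Fin (e + 2) → ℂ := fun k => (derivative (bk f k)).eval z + (bs f k).eval z with hQ
  set P : Fin (e + 2) → ℂ := fun k => (bk f k).eval z with hP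
  set γ := Q k0 / P k0 with hγ
  refine ⟨γ, fun k => ?_⟩
  set u : Fin (e + 2) → ℂ := fun k => Q k - γ * P k with hu
  have hu0 : u k0 = 0 := by
    simp only [hu, hγ]
    rw [div_mul_cancel₀ _ hP0, sub_self]
  have hann : ∀ i, ∑ k, u k * (derivative^[(k : ℕ)] (f i)).eval z = 0 := by
    intro i
    have h1 := congrArg (eval z) (bk_annih f i)
    have h2 := congrArg (eval z) (bk_annih' f i)
    simp only [eval_add, eval_finsetSum, eval_mul, eval_zero, hz, zero_mul, add_zero] at h1 h2
    simp only [hu, sub_mul, Finset.sum_sub_distrib, mul_assoc, ← Finset.mul_sum]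
    simp only [hQ, hP]
    rw [h1, h2]; simp
  set N : Matrix (Fin (e + 1)) (Fin (e + 1)) ℂ :=
    Matrix.of fun i j => (derivative^[(k0.succAbove j : ℕ)] (f i)).eval z with hN
  have hdet : N.det ≠ 0 := by
    intro h0
    apply hP0
    rw [bk, eval_mul, ← coe_evalRingHom, RingHom.map_det]
    have : (evalRingHom z).mapMatrix (Matrix.of fun i j : Fin (e + 1) => derivative^[(k0.succAbove j : ℕ)] (f i)) = N := by
      ext i j; simp [hN]
    rw [this, h0, mul_zero]
  have huz : (fun j => u (k0.succAbove j)) = 0 := by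
    apply Matrix.eq_zero_of_mulVec_eq_zero hdet
    ext i
    have := hann i
    rw [Fin.sum_univ_succAbove _ k0, hu0, zero_mul, zero_add] at this
    simp only [Matrix.mulVec, dotProduct, hN, Matrix.of_apply, Pi.zero_apply]
    rw [← this]
    exact Finset.sum_congr rfl fun j _ => mul_comm _ _
  have huk : u k = 0 := by
    rcases Fin.eq_self_or_eq_succAbove k0 k with h | ⟨j, rfl⟩
    · rw [h, hu0]
    · exact congrFun huz j
  exact sub_eq_zero.mp huk
end
end Wrk

namespace Wrk

lemma map_bk {R S : Type*} [CommRing R] [CommRing S] {d : ℕ} (φ : R →+* S) (f : Fin d → R[X]) (k : Fin (d + 1)) :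
    bk (fun i => (f i).map φ) k = (bk f k).map φ := by
  rw [bk, bk, Polynomial.map_mul, ← coe_mapRingHom, RingHom.map_det]
  congr 1
  · simp
  · congr 1
    ext1 i j
    simp [iterate_derivative_map]

lemma iterate_map {R S : Type*} [CommRing R] [CommRing S] (φ : R →+* S) (f : R[X]) (k : ℕ) :
    derivative^[k] (f.map φ) = (derivative^[k] f).map φ := by
  simp [iterate_derivative_map]

lemma distinct_succ {e : ℕ} (f : Fin (e + 1) → ℂ[X]) (hf : LinearIndependent ℂ f) (a : Fin (e + 1) → ℕ)
    (ha : ∑ j : Fin (e + 1), (j : ℕ) ≤ ∑ i, a i) (hdeg : ∀ i, (f i).natDegree ≤ a i)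
    (n : ℕ) (hn : n = (∑ i, a i) - ∑ j : Fin (e + 1), (j : ℕ)) (t : Fin n → ℝ) (ht : Function.Injective t)
    (c : ℂ) (hc : c ≠ 0) (hw : wr f = C c * ∏ i, (X - C (t i : ℂ))) (i : Fin (e + 1)) :
    (f i).map (starRingEnd ℂ) ∈ Submodule.span ℂ (Set.range f) := by
  set z : Fin n → ℂ := fun i => (t i : ℂ) with hz
  have hzinj : Function.Injective z := fun i j hij => ht (Complex.ofReal_injective hij)
  have hev : ∀ i, (wr f).eval (z i) = 0 := by
    intro i
    rw [hw, eval_mul, eval_prod, Finset.prod_eq_zero (Finset.mem_univ i), mul_zero]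
    simp [hz]
  have hder : ∀ i, (derivative (wr f)).eval (z i) = c * (wi z i).eval (z i) := by
    intro i
    rw [hw, derivative_C_mul, eval_mul, eval_C, deriv_prod_eval z i]
  have hγ := fun i => local_gamma f (z i) (hev i) (by
    rw [hder]; exact mul_ne_zero hc (wi_eval_self z hzinj i))
  choose γ hγ using hγ
  set p : ℕ → ℂ[X] := fun m => C c⁻¹ * bs f ⟨e + 1 - m, by omega⟩ with hp
  have hbs : ∀ k (hk : k < e + 1), bs f ⟨k + 1, by omega⟩ = bk f ⟨k, by omega⟩ := by
    intro k hk
    exact Fin.cons_succ (α := fun _ => ℂ[X]) (n := e + 1) 0 (fun k => bk f k.castSucc) ⟨k, hk⟩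
  have hpk : ∀ m, m < e + 1 → p m = C c⁻¹ * bk f ⟨e - m, by omega⟩ := by
    intro m hm
    simp only [hp]
    rw [← hbs (e - m) (by omega)]
    congr 3
    omega
  have hp0 : ∀ m, e + 1 ≤ m → p m = 0 := by
    intro m hm
    simp only [hp]
    have : (⟨e + 1 - m, by omega⟩ : Fin (e + 2)) = 0 := by
      apply Fin.ext; simp; omega
    rw [this]
    simp [bs]
  have hreal := real_seq t ht p γ (e + 1) z (fun i => rfl) (by
      intro m
      by_cases hm : m < e + 1
      · rw [hpk m hm, hn, ← smul_eq_C_mul]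
        exact lt_of_le_of_lt (degree_smul_le _ _) (bk_deg_lt f a hdeg ⟨e - m, by omega⟩ ha)
      · rw [hp0 m (by omega), degree_zero]
        exact WithBot.bot_lt_coe _) (by
      intro i
      rw [hpk 0 (by omega), eval_mul, eval_C]
      have : bk f ⟨e - 0, by omega⟩ = - derivative (wr f) := bk_pred f
      rw [this, eval_neg, hder, mul_neg, inv_mul_cancel_left₀ hc]) (hp0 _ le_rfl) (by
      intro m hm i
      have h1 := hγ i ⟨e - m, by omega⟩
      have h2 : p (m + 1) = C c⁻¹ * bs f ⟨e - m, by omega⟩ := by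
        simp only [hp]
        congr 3
        omega
      rw [h2, hpk m hm, derivative_C_mul, eval_mul, eval_mul, eval_mul, eval_C, ← mul_add, h1]
      ring)
  have hcbk : ∀ k : Fin (e + 2), C (starRingEnd ℂ c⁻¹) * (bk f k).map (starRingEnd ℂ) = C c⁻¹ * bk f k := by
    intro k
    refine Fin.lastCases ?_ (fun k => ?_) k
    · rw [bk_last, hw, Polynomial.map_mul, map_C, ← mul_assoc, ← C_mul, ← map_mul, inv_mul_cancel₀ hc,
        ← mul_assoc, ← C_mul, inv_mul_cancel₀ hc, map_one, C_1, one_mul, one_mul, Polynomial.map_prod]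
      refine Finset.prod_congr rfl fun j _ => ?_
      simp [hz]
    · have h1 := hreal (e - k) (by omega)
      rw [hpk _ (by omega)] at h1
      have h3 : (⟨e - (e - (k : ℕ)), by omega⟩ : Fin (e + 2)) = k.castSucc := by
        apply Fin.ext; simp; omega
      rw [h3, Polynomial.map_mul, map_C] at h1
      exact h1
  apply mem_span_of_annih f hf
  have h1 := congrArg (fun q => C (starRingEnd ℂ c⁻¹) * Polynomial.map (starRingEnd ℂ) q) (bk_annih f i)
  simp only [Polynomial.map_sum, Polynomial.map_mul, Polynomial.map_zero, mul_zero, Finset.mul_sum, ← mul_assoc, hcbk,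
    ← iterate_map] at h1
  simp only [mul_assoc, ← Finset.mul_sum] at h1
  exact (mul_eq_zero.mp h1).resolve_left (by simpa using hc)

lemma fixed_of_reduced {K : Type*} [Field K] {d : ℕ} (φ : K →+* K) (f : Fin d → K[X]) (a : Fin d → ℕ)
    (h : ∀ i j, (f i).coeff (a j) = if i = j then 1 else 0) (i : Fin d)
    (hs : (f i).map φ ∈ Submodule.span K (Set.range f)) : (f i).map φ = f i := by
  obtain ⟨c, hc⟩ := (Submodule.mem_span_range_iff_exists_fun K).mp hs
  have hcj : ∀ j, c j = if i = j then 1 else 0 := by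
    intro j
    have := congrArg (fun q => coeff q (a j)) hc
    simp only [finsetSum_coeff, coeff_smul, smul_eq_mul, h, coeff_map] at this
    simp only [mul_ite, mul_one, mul_zero, Finset.sum_ite_eq', Finset.mem_univ, if_true] at this
    rw [this]
    split_ifs <;> simp
  rw [← hc]
  simp [hcj]

/-- Reduced bases with Wronskian having distinct real roots are real. -/
theorem distinct_real {d : ℕ} (f : Fin d → ℂ[X]) (hf : LinearIndependent ℂ f) (a : Fin d → ℕ)
    (ha : StrictMono a) (hdeg : ∀ i, (f i).natDegree ≤ a i)
    (hred : ∀ i j, (f i).coeff (a j) = if i = j then 1 else 0)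
    (n : ℕ) (hn : n = (∑ i, a i) - ∑ j : Fin d, (j : ℕ)) (t : Fin n → ℝ) (ht : Function.Injective t)
    (c : ℂ) (hc : c ≠ 0) (hw : wr f = C c * ∏ i, (X - C (t i : ℂ))) (i : Fin d) :
    (f i).map (starRingEnd ℂ) = f i := by
  cases d with
  | zero => exact i.elim0
  | succ e =>
    exact fixed_of_reduced _ f a hred i
      (distinct_succ f hf a (strictMono_le a ha) hdeg n hn t ht c hc hw i)
end Wrk

namespace Wrk
section
variable {K : Type*} [Field K] {d : ℕ}

lemma residue_charZero (O : ValuationSubring K) (hO : ∀ k : ℕ, k ≠ 0 → (k : K) ≠ 0 ∧ (k : K)⁻¹ ∈ O) :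
    CharZero (IsLocalRing.ResidueField O) := by
  apply charZero_of_inj_zero
  intro k hk
  by_contra h0
  obtain ⟨h1, h2⟩ := hO k h0
  have h3 : ((k : ℕ) : O) * ⟨(k : K)⁻¹, h2⟩ = 1 := by
    apply Subtype.ext
    simp [mul_inv_cancel₀ h1]
  have h4 := congrArg (IsLocalRing.residue O) h3
  rw [map_mul, map_natCast, hk, zero_mul, map_one] at h4
  exact zero_ne_one h4

lemma val_integral (O : ValuationSubring K) (hO : ∀ k : ℕ, k ≠ 0 → (k : K) ≠ 0 ∧ (k : K)⁻¹ ∈ O)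
    (f : Fin d → K[X]) (a : Fin d → ℕ)
    (hred : ∀ i j, (f i).coeff (a j) = if i = j then 1 else 0)
    (hw : ∀ m, (wr f).coeff m ∈ O) (i : Fin d) (m : ℕ) : (f i).coeff m ∈ O := by
  classical
  -- bound on indices
  obtain ⟨B, hB⟩ : ∃ B : ℕ, (∀ i, a i < B) ∧ (∀ i, (f i).natDegree < B) ∧ m < B := by
    refine ⟨∑ i, a i + ∑ i, (f i).natDegree + m + 1, fun i => ?_, fun i => ?_, by omega⟩
    · have := Finset.single_le_sum (f := a) (fun _ _ => Nat.zero_le _) (Finset.mem_univ i)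
      omega
    · have := Finset.single_le_sum (f := fun i => (f i).natDegree) (fun _ _ => Nat.zero_le _) (Finset.mem_univ i)
      omega
  obtain ⟨hBa, hBf, hBm⟩ := hB
  set F : (Fin d → ℕ) → Matrix (Fin d) (Fin d) K := fun J => Matrix.of fun k l => (f k).coeff (J l) with hF
  have hupd : ∀ (J : Fin d → ℕ) (l : Fin d) (m : ℕ),
      F (Function.update J l m) = (F J).updateCol l (fun k => (f k).coeff m) := by
    intro J l m
    ext k l'
    by_cases h : l' = l
    · subst h; simp [hF]
    · simp [hF, Matrix.updateCol_ne h, Function.update_of_ne h]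
  have hFa : F a = 1 := by
    ext k l
    simp [hF, hred, Matrix.one_apply]
  have : Nonempty (Fin B) := ⟨⟨m, hBm⟩⟩
  obtain ⟨J0, hJ0⟩ := Finite.exists_max (fun J : Fin d → Fin B => O.valuation (F (fun l => (J l : ℕ))).det)
  set J : Fin d → ℕ := fun l => (J0 l : ℕ) with hJ
  have hmax : ∀ J' : Fin d → ℕ, (∀ l, J' l < B) → O.valuation (F J').det ≤ O.valuation (F J).det :=
    fun J' h => hJ0 (fun l => ⟨J' l, h l⟩)
  have hJB : ∀ l, J l < B := fun l => (J0 l).2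
  have hge : 1 ≤ O.valuation (F J).det := by
    have := hmax a hBa
    rwa [hFa, Matrix.det_one, map_one] at this
  have hdet : (F J).det ≠ 0 := by
    intro h
    rw [h, map_zero] at hge
    exact absurd hge (by simp)
  set P := (F J)⁻¹ with hP
  have hPF : P * F J = 1 := Matrix.nonsing_inv_mul _ (isUnit_iff_ne_zero.mpr hdet)
  set g : Fin d → K[X] := fun i => ∑ k, C (P i k) * f k with hg
  have hgc : ∀ i m, (g i).coeff m = ∑ k, P i k * (f k).coeff m := by
    intro i m
    simp [hg, finsetSum_coeff]
  have hgJ : ∀ i l, (g i).coeff (J l) = if i = l then 1 else 0 := by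
    intro i l
    rw [hgc, ← Matrix.one_apply, ← hPF]
    rfl
  have hgO : ∀ i m, (g i).coeff m ∈ O := by
    intro i m
    by_cases hm : m < B
    · have h1 : (g i).coeff m = (F J).det⁻¹ * (F (Function.update J i m)).det := by
        rw [hgc, hupd, ← Matrix.cramer_apply, Matrix.cramer_eq_adjugate_mulVec, hP, Matrix.inv_def,
          Ring.inverse_eq_inv']
        simp only [Matrix.smul_apply, smul_eq_mul, Matrix.mulVec, dotProduct, Finset.mul_sum, mul_assoc]
      rw [h1, ← ValuationSubring.valuation_le_one_iff, map_mul, map_inv₀]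
      have h2 : O.valuation (F (Function.update J i m)).det ≤ O.valuation (F J).det := by
        apply hmax
        intro l
        by_cases h : l = i
        · subst h; simpa using hm
        · simpa [Function.update_of_ne h] using hJB l
      have h3 : O.valuation (F J).det ≠ 0 := by simpa using hdet
      rw [inv_mul_le_iff₀ (zero_lt_iff.mpr h3), mul_one]
      exact h2
    · rw [hgc]
      have : ∀ k, (f k).coeff m = 0 := fun k => coeff_eq_zero_of_natDegree_lt (by have := hBf k; omega)
      simp [this, O.zero_mem]
  -- lift to O and reduce
  have hsub : ∀ i, (((g i).coeffs : Finset K) : Set K) ⊆ O.toSubring := by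
    intro i x hx
    obtain ⟨m, -, rfl⟩ := Polynomial.mem_coeffs_iff.mp hx
    exact hgO i m
  have hlift : ∀ i, ∃ q : O[X], q.map O.subtype = g i := by
    intro i
    refine ⟨(g i).toSubring O.toSubring (hsub i), ?_⟩
    exact Polynomial.map_toSubring (g i) O.toSubring (hsub i)
  choose q hq using hlift
  have hqc : ∀ i m, (((q i).coeff m : O) : K) = (g i).coeff m := by
    intro i m
    rw [← hq i, coeff_map]; rfl
  have := residue_charZero O hO
  set ρ := IsLocalRing.residue O with hρ
  have hli : LinearIndependent (IsLocalRing.ResidueField O) (fun i => (q i).map ρ) := by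
    rw [Fintype.linearIndependent_iff]
    intro c hc l
    have := congrArg (fun p => coeff p (J l)) hc
    simp only [finsetSum_coeff, coeff_smul, coeff_map, smul_eq_mul, coeff_zero] at this
    have hqJ : ∀ i, (q i).coeff (J l) = if i = l then 1 else 0 := by
      intro i
      apply Subtype.ext
      rw [hqc, hgJ]
      split_ifs <;> simp
    simp only [hqJ] at this
    simpa using this
  have hne := wr_ne_zero _ hli
  rw [wr_map] at hne
  obtain ⟨m0, hm0⟩ : ∃ m0, ((wr q).map ρ).coeff m0 ≠ 0 := by
    by_contra hcon
    push Not at hcon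
    exact hne (Polynomial.ext (by simpa using hcon))
  have hunit : IsUnit ((wr q).coeff m0) := by
    rw [coeff_map] at hm0
    exact (IsLocalRing.residue_ne_zero_iff_isUnit _).mp hm0
  have hwg : wr g = (wr q).map O.subtype := by
    rw [← wr_map]
    congr 1
    funext i
    exact (hq i).symm
  have hwg2 : wr g = C P.det * wr f := wr_lin P f g fun i => rfl
  have hv : O.valuation (P.det * (wr f).coeff m0) = 1 := by
    rw [← coeff_C_mul, ← hwg2, hwg, coeff_map]
    exact (O.valuation_eq_one_iff _).mp hunit
  have hPd : P.det = (F J).det⁻¹ := by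
    rw [hP, Matrix.det_nonsing_inv, Ring.inverse_eq_inv']
  have hle : O.valuation (F J).det ≤ 1 := by
    rw [map_mul, hPd, map_inv₀] at hv
    have h3 : O.valuation (F J).det ≠ 0 := by simpa using hdet
    rw [inv_mul_eq_one₀ h3] at hv
    rw [hv]
    exact (O.valuation_le_one_iff _).mpr (hw m0)
  have hfin := (hmax (Function.update a i m) (by
        intro l
        by_cases h : l = i
        · subst h; simpa using hBm
        · simpa [Function.update_of_ne h] using hBa l)).trans hle
  rw [hupd, hFa, ← Matrix.cramer_apply, Matrix.cramer_one] at hfin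
  exact (O.valuation_le_one_iff _).mp hfin
end
end Wrk

namespace Fin1
variable {B : Type} [Finite B] {n : ℕ}

/-- Evaluation of bivariate polynomial. -/
lemma exists_point (H : Fin n → MvPolynomial B ℂ)
    (hinteg : (MvPolynomial.aeval H : MvPolynomial (Fin n) ℂ →ₐ[ℂ] MvPolynomial B ℂ).toRingHom.IsIntegral)
    (hinj : Function.Injective (MvPolynomial.aeval H : MvPolynomial (Fin n) ℂ →ₐ[ℂ] MvPolynomial B ℂ))
    (a : MvPolynomial B ℂ) :
    ∃ Q : (MvPolynomial (Fin n) ℂ)[X], Q.Monic ∧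
      (∀ x : B → ℂ, (Q.map (MvPolynomial.eval (fun k => MvPolynomial.eval x (H k)))).eval (MvPolynomial.eval x a) = 0) ∧
      ∀ (η : Fin n → ℂ) (t : ℂ), (Q.map (MvPolynomial.eval η)).eval t = 0 →
        ∃ x : B → ℂ, (∀ k, MvPolynomial.eval x (H k) = η k) ∧ MvPolynomial.eval x a = t := by
  let alg : Algebra (MvPolynomial (Fin n) ℂ) (MvPolynomial B ℂ) :=
    (MvPolynomial.aeval H : MvPolynomial (Fin n) ℂ →ₐ[ℂ] MvPolynomial B ℂ).toRingHom.toAlgebra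
  have halg : ∀ p, algebraMap (MvPolynomial (Fin n) ℂ) (MvPolynomial B ℂ) p = MvPolynomial.aeval H p := fun _ => rfl
  have hfs : Module.IsTorsionFree (MvPolynomial (Fin n) ℂ) (MvPolynomial B ℂ) := by
    rw [Module.isTorsionFree_iff_faithfulSMul, faithfulSMul_iff_algebraMap_injective]
    exact hinj
  have ha : IsIntegral (MvPolynomial (Fin n) ℂ) a := hinteg a
  refine ⟨minpoly (MvPolynomial (Fin n) ℂ) a, minpoly.monic ha, ?_, ?_⟩
  · intro x
    have h1 := minpoly.aeval (MvPolynomial (Fin n) ℂ) a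
    have h2 := congrArg (MvPolynomial.eval x) h1
    rw [map_zero, Polynomial.aeval_def, Polynomial.hom_eval₂] at h2
    rw [Polynomial.eval_map, ← h2]
    congr 1
    ext k
    · simp [halg]
    · simp [halg]
  · intro η t ht
    set ψ : (MvPolynomial (Fin n) ℂ)[X] →+* ℂ := Polynomial.eval₂RingHom (MvPolynomial.eval η) t with hψ
    let alg2 : Algebra (MvPolynomial (Fin n) ℂ)[X] (MvPolynomial B ℂ) :=
      (Polynomial.aeval a : (MvPolynomial (Fin n) ℂ)[X] →ₐ[MvPolynomial (Fin n) ℂ] MvPolynomial B ℂ).toRingHom.toAlgebra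
    have halg2 : ∀ p, algebraMap (MvPolynomial (Fin n) ℂ)[X] (MvPolynomial B ℂ) p = Polynomial.aeval a p := fun _ => rfl
    have hint2 : Algebra.IsIntegral (MvPolynomial (Fin n) ℂ)[X] (MvPolynomial B ℂ) := by
      constructor
      intro r
      obtain ⟨p, hp1, hp2⟩ := hinteg r
      refine ⟨p.map C, hp1.map _, ?_⟩
      rw [Polynomial.eval₂_map, ← hp2]
      congr 1
      ext k
      · simp [halg2, halg]
      · simp [halg2, halg]
    have hsurj : Function.Surjective ψ := by
      intro c
      exact ⟨C (MvPolynomial.C c), by simp [hψ]⟩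
    have hmax : (RingHom.ker ψ).IsMaximal := RingHom.ker_isMaximal_of_surjective ψ hsurj
    have hker : RingHom.ker (algebraMap (MvPolynomial (Fin n) ℂ)[X] (MvPolynomial B ℂ)) ≤ RingHom.ker ψ := by
      intro p hp
      rw [RingHom.mem_ker, halg2] at hp
      obtain ⟨q, rfl⟩ := minpoly.isIntegrallyClosed_dvd ha hp
      rw [RingHom.mem_ker, map_mul]
      have : ψ (minpoly (MvPolynomial (Fin n) ℂ) a) = 0 := by
        rw [Polynomial.eval_map] at ht
        simpa [hψ] using ht
      rw [this, zero_mul]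
    obtain ⟨m, hm, hcomap⟩ := Ideal.exists_ideal_over_maximal_of_isIntegral (RingHom.ker ψ) hker
    obtain ⟨x, rfl⟩ := (MvPolynomial.isMaximal_iff_eq_vanishingIdeal_singleton).mp hm
    have key : ∀ p, ψ p = 0 → MvPolynomial.eval x (Polynomial.aeval a p) = 0 := by
      intro p hp
      have : p ∈ Ideal.comap (algebraMap (MvPolynomial (Fin n) ℂ)[X] (MvPolynomial B ℂ)) (MvPolynomial.vanishingIdeal ℂ {x}) := by
        rw [hcomap]; exact hp
      rw [Ideal.mem_comap, MvPolynomial.mem_vanishingIdeal_iff] at this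
      have h2 := this x rfl
      rw [halg2] at h2
      simpa [MvPolynomial.aeval_eq_eval] using h2
    refine ⟨x, fun k => ?_, ?_⟩
    · have := key (C (MvPolynomial.X k) - C (MvPolynomial.C (η k))) (by simp [hψ])
      rw [map_sub, Polynomial.aeval_C, Polynomial.aeval_C, halg, halg] at this
      simpa [sub_eq_zero] using this
    · have := key (X - C (MvPolynomial.C t)) (by simp [hψ])
      rw [map_sub, Polynomial.aeval_X, Polynomial.aeval_C, halg] at this
      simpa [sub_eq_zero] using this

lemma injective_of_card (H : Fin n → MvPolynomial B ℂ) (hcard : Nat.card B = n)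
    (hinteg : (MvPolynomial.aeval H : MvPolynomial (Fin n) ℂ →ₐ[ℂ] MvPolynomial B ℂ).toRingHom.IsIntegral) :
    Function.Injective (MvPolynomial.aeval H : MvPolynomial (Fin n) ℂ →ₐ[ℂ] MvPolynomial B ℂ) := by
  have h1 : Algebra.IsIntegral (Algebra.adjoin ℂ (Set.range H)) (MvPolynomial B ℂ) := by
    constructor
    intro r
    obtain ⟨p, hp1, hp2⟩ := hinteg r
    set φ : MvPolynomial (Fin n) ℂ →ₐ[ℂ] Algebra.adjoin ℂ (Set.range H) :=
      MvPolynomial.aeval (fun k => (⟨H k, Algebra.subset_adjoin ⟨k, rfl⟩⟩ : Algebra.adjoin ℂ (Set.range H))) with hφ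
    refine ⟨p.map φ.toRingHom, hp1.map _, ?_⟩
    rw [Polynomial.eval₂_map, ← hp2]
    congr 1
    ext k
    · simp [hφ]
    · simp [hφ]
  have h2 := Algebra.IsAlgebraic.isTranscendenceBasis_of_le_trdeg_of_finite ℂ H (by
    rw [MvPolynomial.trdeg_of_isDomain, Cardinal.lift_id, ← Nat.cast_card (α := B), hcard]
    simp)
  exact h2.1

lemma prod_lower (t : ℂ) (s : Multiset ℂ) (hs : ∀ r ∈ s, r.im = 0) :
    |t.im| ^ (Multiset.card s) ≤ ‖(s.map (fun r => t - r)).prod‖ := by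
  induction s using Multiset.induction_on with
  | empty => simp
  | cons r s ih =>
    have h1 := ih fun r hr => hs r (Multiset.mem_cons_of_mem hr)
    have h2 : |t.im| ≤ ‖t - r‖ := by
      have := Complex.abs_im_le_norm (t - r)
      rwa [Complex.sub_im, hs r (Multiset.mem_cons_self r s), sub_zero] at this
    rw [Multiset.map_cons, Multiset.prod_cons, Multiset.card_cons, pow_succ', norm_mul]
    exact mul_le_mul h2 h1 (by positivity) (by positivity)

lemma monic_lower (p : ℂ[X]) (hp : p.Monic) (hr : ∀ r, p.eval r = 0 → r.im = 0) (t : ℂ) :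
    |t.im| ^ p.natDegree ≤ ‖p.eval t‖ := by
  have hs := IsAlgClosed.splits p
  rw [hs.eval_eq_prod_roots_of_monic hp, hs.natDegree_eq_card_roots]
  exact prod_lower t _ fun r h => hr r (by simpa using (Polynomial.mem_roots'.mp h).2)

open Filter Topology in
theorem limit_real (H : Fin n → MvPolynomial B ℂ) (hcard : Nat.card B = n)
    (hinteg : (MvPolynomial.aeval H : MvPolynomial (Fin n) ℂ →ₐ[ℂ] MvPolynomial B ℂ).toRingHom.IsIntegral)
    (η : ℕ → Fin n → ℂ) (η0 : Fin n → ℂ) (hη : Tendsto η atTop (𝓝 η0))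
    (hreal : ∀ m x, (∀ k, MvPolynomial.eval x (H k) = η m k) → ∀ b, (x b).im = 0)
    (x : B → ℂ) (hx : ∀ k, MvPolynomial.eval x (H k) = η0 k) (b : B) : (x b).im = 0 := by
  obtain ⟨Q, hQ, h1, h2⟩ := exists_point H hinteg (injective_of_card H hcard hinteg) (MvPolynomial.X b)
  have hcont : Continuous fun ξ : Fin n → ℂ => (Q.map (MvPolynomial.eval ξ)).eval (x b) := by
    simp only [Polynomial.eval_map, Polynomial.eval₂_eq_sum_range]
    refine continuous_finsetSum _ fun k _ => ?_
    exact (MvPolynomial.continuous_eval _).mul continuous_const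
  have hlim : Tendsto (fun m => ‖(Q.map (MvPolynomial.eval (η m))).eval (x b)‖) atTop (𝓝 0) := by
    have h3 := ((hcont.norm.tendsto η0).comp hη)
    have h4 := h1 x
    simp only [hx, MvPolynomial.eval_X] at h4
    rw [h4, norm_zero] at h3
    exact h3
  have hle : |(x b).im| ^ Q.natDegree ≤ 0 := by
    refine ge_of_tendsto' hlim fun m => ?_
    have h5 := monic_lower (Q.map (MvPolynomial.eval (η m))) (hQ.map _) (fun r hr => ?_) (x b)
    · rwa [hQ.natDegree_map] at h5
    · obtain ⟨y, hy1, hy2⟩ := h2 (η m) r hr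
      rw [← hy2, MvPolynomial.eval_X]
      exact hreal m y hy1 b
  exact abs_eq_zero.mp (eq_zero_of_pow_eq_zero (le_antisymm hle (by positivity)))
end Fin1

namespace Wrk
section
variable {d : ℕ}

/-- Index set of free coefficients. -/
abbrev Bx (a : Fin d → ℕ) : Type := Σ i : Fin d, {j : Fin (a i) // ¬ ∃ k, a k = j}

lemma card_Bx (a : Fin d → ℕ) (ha : StrictMono a) :
    Nat.card (Bx a) = (∑ i, a i) - ∑ j : Fin d, (j : ℕ) := by
  rw [Nat.card_eq_fintype_card, Fintype.card_sigma]
  have h1 : ∀ i : Fin d, Fintype.card {j : Fin (a i) // ¬ ∃ k, a k = j} = a i - i := by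
    intro i
    rw [Fintype.card_subtype_compl, Fintype.card_fin]
    congr 1
    have e : Fin i ≃ {j : Fin (a i) // ∃ k, a k = j} := by
      refine Equiv.ofBijective (fun k => ⟨⟨a ⟨k, by omega⟩, ha (Fin.mk_lt_of_lt_val k.2)⟩, ⟨_, rfl⟩⟩) ⟨?_, ?_⟩
      · intro k l hkl
        simp only [Subtype.mk.injEq, Fin.mk.injEq] at hkl
        have := ha.injective hkl
        simp only [Fin.mk.injEq] at this
        exact Fin.ext this
      · rintro ⟨⟨j, hj⟩, ⟨k, hk⟩⟩
        simp only at hk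
        have hki : k < i := by
          rw [← ha.lt_iff_lt, hk]; exact hj
        refine ⟨⟨k, hki⟩, ?_⟩
        simp [hk]
    rw [← Fintype.card_congr e, Fintype.card_fin]
  have h2 : ∀ i : Fin d, (i : ℕ) ≤ a i := by
    intro i
    have := Fintype.card_le_of_injective
      (fun k : Fin i => (⟨a ⟨k, by omega⟩, ha (Fin.mk_lt_of_lt_val k.2)⟩ : Fin (a i))) (by
        intro k l hkl
        simp only [Fin.mk.injEq] at hkl
        have := ha.injective hkl
        simp only [Fin.mk.injEq] at this
        exact Fin.ext this)
    simpa using this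
  simp only [h1]
  rw [eq_comm, Nat.sub_eq_iff_eq_add (strictMono_le a ha), ← Finset.sum_add_distrib]
  exact Finset.sum_congr rfl fun i _ => (Nat.sub_add_cancel (h2 i)).symm

/-- Universal reduced family. -/
noncomputable def rf {S : Type*} [CommRing S] (a : Fin d → ℕ) (c : Bx a → S) (i : Fin d) : S[X] :=
  X ^ (a i) + ∑ j : {j : Fin (a i) // ¬ ∃ k, a k = j}, C (c ⟨i, j⟩) * X ^ ((j : Fin (a i)) : ℕ)

section
variable {S : Type*} [CommRing S] (a : Fin d → ℕ) (c : Bx a → S)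

lemma rf_map {T : Type*} [CommRing T] (φ : S →+* T) (i : Fin d) :
    (rf a c i).map φ = rf a (fun b => φ (c b)) i := by
  simp [rf, Polynomial.map_sum]

lemma rf_coeff (i : Fin d) (m : ℕ) : (rf a c i).coeff m =
    (if m = a i then 1 else 0) +
      ∑ j : {j : Fin (a i) // ¬ ∃ k, a k = j}, if m = ((j : Fin (a i)) : ℕ) then c ⟨i, j⟩ else 0 := by
  rw [rf, coeff_add, coeff_X_pow, finsetSum_coeff]
  simp only [coeff_C_mul, coeff_X_pow, mul_ite, mul_one, mul_zero]

lemma rf_coeff_b (i : Fin d) (j : {j : Fin (a i) // ¬ ∃ k, a k = j}) :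
    (rf a c i).coeff ((j : Fin (a i)) : ℕ) = c ⟨i, j⟩ := by
  rw [rf_coeff, if_neg (j.1.2.ne), zero_add, Finset.sum_eq_single j]
  · simp
  · intro j' _ hj
    rw [if_neg]
    intro h
    exact hj (Subtype.ext (Fin.ext h.symm))
  · simp

lemma rf_coeff_a (ha : StrictMono a) (i k : Fin d) :
    (rf a c i).coeff (a k) = if i = k then 1 else 0 := by
  rw [rf_coeff, Finset.sum_eq_zero, add_zero]
  · simp only [ha.injective.eq_iff, eq_comm]
  · intro j _
    rw [if_neg]
    intro h
    exact j.2 ⟨k, h⟩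

lemma rf_coeff_gt (i : Fin d) (m : ℕ) (hm : a i < m) : (rf a c i).coeff m = 0 := by
  rw [rf_coeff, if_neg hm.ne', zero_add]
  refine Finset.sum_eq_zero fun j _ => ?_
  rw [if_neg]
  have := j.1.2
  omega

lemma rf_natDegree (i : Fin d) : (rf a c i).natDegree ≤ a i := by
  rw [natDegree_le_iff_coeff_eq_zero]
  exact fun m hm => rf_coeff_gt a c i m hm

lemma eq_rf (ha : StrictMono a) (f : Fin d → S[X]) (hd : ∀ i, (f i).natDegree ≤ a i)
    (hred : ∀ i j, (f i).coeff (a j) = if i = j then 1 else 0) :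
    f = rf a (fun b => (f b.1).coeff ((b.2 : Fin (a b.1)) : ℕ)) := by
  funext i
  ext m
  by_cases h1 : a i < m
  · rw [rf_coeff_gt _ _ _ _ h1, coeff_eq_zero_of_natDegree_lt ((hd i).trans_lt h1)]
  by_cases h2 : ∃ k, a k = m
  · obtain ⟨k, rfl⟩ := h2
    rw [rf_coeff_a _ _ ha, hred]
  · have h3 : m < a i := lt_of_le_of_ne (not_lt.mp h1) fun h => h2 ⟨i, h.symm⟩
    exact (rf_coeff_b a (fun b => (f b.1).coeff ((b.2 : Fin (a b.1)) : ℕ)) i ⟨⟨m, h3⟩, h2⟩).symm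

lemma rf_wr (ha : StrictMono a) :
    (wr (rf a c)).natDegree ≤ (∑ i, a i) - ∑ j : Fin d, (j : ℕ) ∧
    (wr (rf a c)).coeff ((∑ i, a i) - ∑ j : Fin d, (j : ℕ)) = vd S a := by
  obtain ⟨h1, h2⟩ := wr_deg (rf a c) a (strictMono_le a ha) (rf_natDegree a c)
  refine ⟨h1, ?_⟩
  rw [h2]
  simp [rf_coeff_a a c ha]

end

lemma rf_li {K : Type*} [Field K] (a : Fin d → ℕ) (ha : StrictMono a) (c : Bx a → K) :
    LinearIndependent K (rf a c) := by
  rw [Fintype.linearIndependent_iff]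
  intro g hg l
  have := congrArg (fun p => coeff p (a l)) hg
  simp only [finsetSum_coeff, coeff_smul, smul_eq_mul, coeff_zero, rf_coeff_a a c ha] at this
  simpa using this

/-- Coefficients of the universal Wronskian. -/
noncomputable def Hc (a : Fin d → ℕ) (n : ℕ) (k : Fin n) : MvPolynomial (Bx a) ℂ :=
  (wr (rf a (fun b => (MvPolynomial.X b : MvPolynomial (Bx a) ℂ)))).coeff k

lemma Hc_eval (a : Fin d → ℕ) (n : ℕ) (k : Fin n) (x : Bx a → ℂ) :
    MvPolynomial.eval x (Hc a n k) = (wr (rf a x)).coeff k := by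
  rw [Hc, ← coeff_map, ← wr_map]
  congr 2
  funext i
  rw [rf_map]
  simp

lemma Hc_integral (a : Fin d → ℕ) (ha : StrictMono a) (n : ℕ)
    (hn : n = (∑ i, a i) - ∑ j : Fin d, (j : ℕ)) :
    (MvPolynomial.aeval (Hc a n) : MvPolynomial (Fin n) ℂ →ₐ[ℂ] MvPolynomial (Bx a) ℂ).toRingHom.IsIntegral := by
  set φ := (MvPolynomial.aeval (Hc a n) : MvPolynomial (Fin n) ℂ →ₐ[ℂ] MvPolynomial (Bx a) ℂ).toRingHom with hφ
  have hφC : ∀ c, φ (MvPolynomial.C c) = MvPolynomial.C c := by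
    intro c
    simp [hφ, MvPolynomial.algebraMap_eq]
  have hφX : ∀ k, φ (MvPolynomial.X k) = Hc a n k := by
    intro k
    simp [hφ]
  let R := MvPolynomial (Bx a) ℂ
  let K := FractionRing R
  let ι : R →+* K := algebraMap R K
  have hι : Function.Injective ι := IsFractionRing.injective R K
  have hX : ∀ b : Bx a, φ.IsIntegralElem (MvPolynomial.X b) := by
    intro b
    set s : Set K := Set.range (ι.comp φ) with hs
    have h1 : ι (MvPolynomial.X b) ∈ (integralClosure (Subring.closure s) K).toSubring := by
      rw [← iInf_valuationSubring_superset]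
      rw [Subring.mem_iInf]
      rintro ⟨V, hV⟩
      have hC : ∀ c : ℂ, ι (MvPolynomial.C c) ∈ V := by
        intro c
        apply hV
        exact ⟨MvPolynomial.C c, by simp [hφC]⟩
      have hH : ∀ k, ι (Hc a n k) ∈ V := by
        intro k
        apply hV
        exact ⟨MvPolynomial.X k, by simp [hφX]⟩
      have hnat : ∀ k : ℕ, (k : K) = ι (MvPolynomial.C (k : ℂ)) := by
        intro k; simp
      have hwm : wr (rf a (fun b => ι (MvPolynomial.X b))) =
          (wr (rf a (fun b => (MvPolynomial.X b : R)))).map ι := by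
        rw [← wr_map]
        congr 1
        funext i
        rw [rf_map]
      have h2 := val_integral V (by
          intro k hk
          refine ⟨?_, ?_⟩
          · rw [hnat]
            simpa using hk
          · have := hC (k : ℂ)⁻¹
            have h3 : (k : K)⁻¹ = ι (MvPolynomial.C (k : ℂ)⁻¹) := by
              apply inv_eq_of_mul_eq_one_left
              rw [hnat, ← map_mul, ← map_mul, inv_mul_cancel₀ (by exact_mod_cast hk), map_one, map_one]
            rw [h3]; exact this) (rf a (fun b => ι (MvPolynomial.X b))) a
          (rf_coeff_a a _ ha) (by
          intro m
          rw [hwm, coeff_map]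
          rcases lt_trichotomy m n with hm | hm | hm
          · exact hH ⟨m, hm⟩
          · have h4 := (rf_wr a (fun b => (MvPolynomial.X b : R)) ha).2
            rw [hm, hn, h4, ← vd_map (MvPolynomial.C : ℂ →+* R)]
            exact hC _
          · have h4 := (rf_wr a (fun b => (MvPolynomial.X b : R)) ha).1
            rw [coeff_eq_zero_of_natDegree_lt (by omega), map_zero]
            exact V.zero_mem) b.1 ((b.2 : Fin (a b.1)) : ℕ)
      rw [rf_coeff_b] at h2
      exact h2
    have h5 : IsIntegral (Subring.closure s) (ι (MvPolynomial.X b)) := h1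
    obtain ⟨p, hp1, hp2⟩ := h5
    have hle : Subring.closure s ≤ (ι.comp φ).range := by
      rw [Subring.closure_le]
      rintro _ ⟨y, rfl⟩
      exact ⟨y, rfl⟩
    have hlift : p.map (algebraMap (Subring.closure s) K) ∈ lifts (ι.comp φ) := by
      rw [lifts_iff_coeff_lifts]
      intro m
      rw [coeff_map]
      exact hle (p.coeff m).2
    obtain ⟨q, hq1, -, hq2⟩ := lifts_and_natDegree_eq_and_monic hlift (hp1.map _)
    refine ⟨q, hq2, ?_⟩
    apply hι
    rw [map_zero, hom_eval₂, ← eval_map, hq1, eval_map]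
    exact hp2
  intro r
  induction r using MvPolynomial.induction_on with
  | C c => rw [← hφC]; exact φ.isIntegralElem_map
  | add p q hp hq => exact hp.add φ hq
  | mul_X p b hp => exact hp.mul φ (hX b)

end
end Wrk

namespace Wrk

lemma cont_coeff {ι : Type*} (s : Finset ι) (u : ι → ℝ → ℂ) (hu : ∀ i, Continuous (u i)) :
    ∀ k, Continuous fun ε => (∏ i ∈ s, (X - C (u i ε))).coeff k := by
  classical
  induction s using Finset.induction_on with
  | empty => intro k; simpa using continuous_const
  | insert i s hi ih =>
    intro k
    simp only [Finset.prod_insert hi, sub_mul, coeff_sub, coeff_C_mul]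
    refine Continuous.sub ?_ ((hu i).mul (ih k))
    cases k with
    | zero => simpa using continuous_const
    | succ k => simpa [coeff_X_mul] using ih k

lemma exists_prod (p : ℂ[X]) (hr : ∀ z ∈ p.roots, z.im = 0) :
    ∃ t : Fin p.natDegree → ℝ, Monotone t ∧ p = C p.leadingCoeff * ∏ i, (X - C (t i : ℂ)) := by
  have hs := IsAlgClosed.splits p
  have hcard := hs.natDegree_eq_card_roots
  obtain ⟨l, hl⟩ := Quot.exists_rep p.roots
  change (l : Multiset ℂ) = p.roots at hl
  have hlen : l.length = p.natDegree := by
    rw [hcard, ← hl, Multiset.coe_card]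
  set z : Fin p.natDegree → ℂ := fun i => l.get (i.cast hlen.symm) with hz
  have hzr : ∀ i, z i = ((z i).re : ℂ) := by
    intro i
    apply Complex.ext
    · simp
    · rw [Complex.ofReal_im]
      apply hr
      rw [← hl]
      exact List.get_mem _ _
  have hprod : p = C p.leadingCoeff * ∏ i, (X - C (z i)) := by
    conv_lhs => rw [hs.eq_prod_roots]
    rw [← hl, Multiset.map_coe, Multiset.prod_coe]
    congr 1
    have h1 : l.map (fun a => X - C a) = List.ofFn fun i => X - C (l.get i) := by
      conv_lhs => rw [← List.ofFn_get l]
      rw [List.map_ofFn]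
      rfl
    rw [h1, List.prod_ofFn]
    exact (Fintype.prod_equiv (finCongr hlen.symm) _ _ fun i => rfl).symm
  set σ := Tuple.sort (fun i => (z i).re) with hσ
  refine ⟨fun i => (z (σ i)).re, Tuple.monotone_sort (fun i => (z i).re), ?_⟩
  conv_lhs => rw [hprod]
  congr 1
  rw [← Equiv.prod_comp σ]
  refine Finset.prod_congr rfl fun i _ => ?_
  rw [← hzr]

open Filter Topology in
/-- Reduced bases with real-rooted Wronskian are real. -/
theorem realrooted_real {d : ℕ} (f : Fin d → ℂ[X]) (a : Fin d → ℕ)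
    (ha : StrictMono a) (hm : ∀ i, (f i).Monic) (hdeg : ∀ i, (f i).natDegree = a i)
    (hred : ∀ i j, (f i).coeff (a j) = if i = j then 1 else 0)
    (hr : ∀ z ∈ (wr f).roots, z.im = 0) (i : Fin d) :
    (f i).map (starRingEnd ℂ) = f i := by
  obtain ⟨e1, e2, e3⟩ := wr_reduced f a ha hm hdeg
  have hex := exists_prod (wr f) hr
  generalize (wr f).natDegree = n at hex e1 e2
  obtain ⟨t, ht, hw⟩ := hex
  rw [e2] at hw
  have hv : vd ℂ a ≠ 0 := vd_ne_zero (R := ℂ) a ha.injective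
  have hf := eq_rf a ha f (fun i => (hdeg i).le) hred
  set x0 : Bx a → ℂ := fun b => (f b.1).coeff ((b.2 : Fin (a b.1)) : ℕ) with hx0
  set u : Fin n → ℝ → ℂ := fun i ε => ((t i + (i : ℕ) * ε : ℝ) : ℂ) with hu
  set G : ℝ → ℂ[X] := fun ε => C (vd ℂ a) * ∏ i, (X - C (u i ε)) with hG
  have hG0 : G 0 = wr f := by
    rw [hw]
    simp [hG, hu]
  have hGdeg : ∀ ε, (G ε).natDegree = n ∧ (G ε).coeff n = vd ℂ a := by
    intro ε
    have h1 : (∏ i, (X - C (u i ε))).Monic := monic_prod_of_monic _ _ fun i _ => monic_X_sub_C _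
    have h2 : (∏ i, (X - C (u i ε))).natDegree = n := by
      rw [natDegree_prod_of_monic _ _ fun i _ => monic_X_sub_C _]
      simp
    refine ⟨?_, ?_⟩
    · simp only [hG]
      rw [natDegree_C_mul hv, h2]
    · simp only [hG]
      rw [coeff_C_mul]
      have := h1.coeff_natDegree
      rw [h2] at this
      rw [this, mul_one]
  set η : ℝ → Fin n → ℂ := fun ε k => (G ε).coeff k with hη
  have hcont : Continuous η := by
    refine continuous_pi fun k => ?_
    simp only [hη, hG, coeff_C_mul]
    exact continuous_const.mul (cont_coeff _ u (fun i => by simp only [hu]; fun_prop) k)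
  have hlim : Tendsto (fun m : ℕ => η (1 / ((m : ℝ) + 1))) atTop (𝓝 (η 0)) :=
    (hcont.tendsto 0).comp tendsto_one_div_add_atTop_nhds_zero_nat
  have key := Fin1.limit_real (Hc a n) (by rw [card_Bx a ha, e1]) (Hc_integral a ha n e1)
    _ _ hlim (by
      intro m x hx b
      set ε : ℝ := 1 / ((m : ℝ) + 1) with hε
      have hεpos : 0 < ε := by positivity
      have hwx : wr (rf a x) = G ε := by
        obtain ⟨h1, h2⟩ := rf_wr a x ha
        rw [← e1] at h1 h2
        ext k
        rcases lt_trichotomy k n with hk | hk | hk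
        · have := hx ⟨k, hk⟩
          rw [Hc_eval] at this
          exact this
        · rw [hk, h2, (hGdeg ε).2]
        · rw [coeff_eq_zero_of_natDegree_lt (lt_of_le_of_lt h1 hk),
            coeff_eq_zero_of_natDegree_lt (by rw [(hGdeg ε).1]; exact hk)]
      have hinj : Function.Injective fun i : Fin n => t i + (i : ℕ) * ε := by
        apply StrictMono.injective
        intro i j hij
        have h1 := ht hij.le
        have h2 : ((i : ℕ) : ℝ) < ((j : ℕ) : ℝ) := by exact_mod_cast hij
        simp only
        nlinarith
      have h3 := distinct_real (rf a x) (rf_li a ha x) a ha (rf_natDegree a x) (rf_coeff_a a x ha)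
        n e1 (fun i => t i + (i : ℕ) * ε) hinj (vd ℂ a) hv hwx b.1
      have h4 := congrArg (fun p => coeff p ((b.2 : Fin (a b.1)) : ℕ)) h3
      simp only [coeff_map] at h4
      rw [rf_coeff_b] at h4
      exact Complex.conj_eq_iff_im.mp h4) x0 (by
      intro k
      rw [Hc_eval, ← hf]
      simp only [hη]
      rw [hG0])
  rw [hf, rf_map]
  congr 1
  funext b
  exact Complex.conj_eq_iff_im.mpr (key b)

/-- Subspaces with real-rooted Wronskian are closed under conjugation. -/
theorem conj_closed {d : ℕ} (f : Fin d → ℂ[X]) (hf : LinearIndependent ℂ f)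
    (hr : ∀ z, (wr f).eval z = 0 → z.im = 0) (p : ℂ[X]) (hp : p ∈ Submodule.span ℂ (Set.range f)) :
    p.map (starRingEnd ℂ) ∈ Submodule.span ℂ (Set.range f) := by
  obtain ⟨a, g, ha, h1, h2, h3, h4, h5⟩ := exists_reduced_basis f hf
  obtain ⟨c, hc⟩ := wr_of_mem_span g f fun i => h5.ge (Submodule.subset_span ⟨i, rfl⟩)
  have hgr := realrooted_real g a ha h1 h2 h3 (fun z hz => hr z (by
    have := (mem_roots'.mp hz).2
    rw [hc, eval_mul, this, mul_zero]))
  rw [← h5] at hp ⊢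
  obtain ⟨w, rfl⟩ := (Submodule.mem_span_range_iff_exists_fun ℂ).mp hp
  rw [Polynomial.map_sum]
  refine Submodule.sum_mem _ fun i _ => ?_
  rw [smul_eq_C_mul, Polynomial.map_mul, map_C, hgr, ← smul_eq_C_mul]
  exact Submodule.smul_mem _ _ (Submodule.subset_span ⟨i, rfl⟩)
end Wrk

namespace Wrk

lemma rotMap_eq (c : ℂ) (p : ℂ[X]) : rotMap c p = p.comp (C c * X) := rfl

lemma rotMap_rotMap (a b : ℂ) (p : ℂ[X]) : rotMap a (rotMap b p) = rotMap (b * a) p := by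
  simp only [rotMap_eq, comp_assoc]
  congr 1
  simp [mul_assoc]

lemma rotMap_one (p : ℂ[X]) : rotMap 1 p = p := by simp [rotMap_eq]

lemma rotMap_inj (c : ℂ) (hc : c ≠ 0) : Function.Injective (rotMap c) := by
  intro p q hpq
  have := congrArg (rotMap c⁻¹) hpq
  rwa [rotMap_rotMap, rotMap_rotMap, mul_inv_cancel₀ hc, rotMap_one, rotMap_one] at this

lemma rotMap_conj (c : ℂ) (p : ℂ[X]) :
    (rotMap c p).map (starRingEnd ℂ) = rotMap (starRingEnd ℂ c) (p.map (starRingEnd ℂ)) := by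
  simp [rotMap_eq, Polynomial.map_comp]

lemma iter_rot (c : ℂ) (j : ℕ) (p : ℂ[X]) :
    (fun p : ℂ[X] => derivative p)^[j] (rotMap c p) =
      C (c ^ j) * rotMap c ((fun p : ℂ[X] => derivative p)^[j] p) := by
  induction j with
  | zero => simp
  | succ j ih =>
    rw [Function.iterate_succ_apply', ih, Function.iterate_succ_apply']
    simp only [rotMap_eq, derivative_C_mul, derivative_comp, derivative_mul, derivative_C,
      derivative_X, zero_mul, zero_add, mul_one, pow_succ, C_mul]
    ring

lemma wronskDet_rot (d : ℕ) (c : ℂ) (f : Fin d → ℂ[X]) :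
    wronskDet d (fun i => rotMap c (f i)) =
      (∏ j : Fin d, C (c ^ (j : ℕ))) * rotMap c (wronskDet d f) := by
  unfold wronskDet
  have h1 : rotMap c (Matrix.det (Matrix.of fun i j : Fin d =>
      (fun p : ℂ[X] => derivative p)^[(j : ℕ)] (f i))) =
      Matrix.det (Matrix.of fun i j : Fin d =>
        rotMap c ((fun p : ℂ[X] => derivative p)^[(j : ℕ)] (f i))) := by
    exact AlgHom.map_det (aeval (C c * X) : ℂ[X] →ₐ[ℂ] ℂ[X]) _
  rw [h1, ← Matrix.det_mul_row]
  congr 1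
  ext1 i j
  simp only [Matrix.of_apply]
  exact iter_rot c j (f i)

lemma twisted_closed {d : ℕ} (h : ℂ[X]) (hne : h ≠ 0) (him : ∀ z ∈ h.roots, z.re = 0)
    (x : Submodule ℂ ℂ[X]) (hx : InFibre d x h) (p : ℂ[X]) (hp : p ∈ x) :
    rotMap (-1) (p.map (starRingEnd ℂ)) ∈ x := by
  obtain ⟨f, c, hc, hli, hspan, hw⟩ := hx
  have hI : Function.Injective (rotMap Complex.I) := rotMap_inj _ Complex.I_ne_zero
  have hli' : LinearIndependent ℂ (fun i => rotMap Complex.I (f i)) :=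
    hli.map' (rotMap Complex.I) (LinearMap.ker_eq_bot.mpr hI)
  have hsp : Submodule.span ℂ (Set.range fun i => rotMap Complex.I (f i)) =
      x.map (rotMap Complex.I) := by
    rw [← hspan, Submodule.map_span, ← Set.range_comp]
    rfl
  have key := conj_closed (fun i => rotMap Complex.I (f i)) hli' (by
    intro z hz
    change (wronskDet d (fun i => rotMap Complex.I (f i))).eval z = 0 at hz
    rw [wronskDet_rot, hw, rotMap_eq, eval_mul, mul_eq_zero] at hz
    rcases hz with hz | hz
    · exfalso
      rw [eval_prod, Finset.prod_eq_zero_iff] at hz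
      obtain ⟨j, -, hj⟩ := hz
      rw [eval_C] at hj
      exact pow_ne_zero _ Complex.I_ne_zero hj
    · rw [eval_comp, eval_smul, smul_eq_mul, mul_eq_zero] at hz
      have h0 := hz.resolve_left hc
      have := him _ ((mem_roots hne).mpr h0)
      simpa using this) (rotMap Complex.I p) (by
    rw [hsp]
    exact Submodule.mem_map_of_mem hp)
  rw [hsp] at key
  obtain ⟨q, hq, hqe⟩ := key
  have h2 : q = rotMap (-1) (p.map (starRingEnd ℂ)) := by
    apply hI
    rw [hqe, rotMap_conj, rotMap_rotMap]
    simp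
  rwa [← h2]
end Wrk

/-- Let `h` be a polynomial of degree at most `N = d(n-d)`
with real coefficients, all of whose roots are purely imaginary.  Then the real
points in the fibre `X(h) = Wr⁻¹(h)` are exactly the points of `X(h)` fixed by
the involution of `X` induced by `diag(-1, 1) ∈ PGL₂(ℂ)` (`z ↦ -z`). -/
theorem statement11 (d n : ℕ) (hd : 0 < d) (hdn : d < n)
    (h : Polynomial ℂ) (hne : h ≠ 0) (hdeg : h.natDegree ≤ d * (n - d))
    (hreal : ∀ k, (h.coeff k).im = 0)
    (him : ∀ z ∈ h.roots, z.re = 0) :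
    ∀ x : Submodule ℂ (Polynomial ℂ), IsGrPoint n d x → InFibre d x h →
      (IsRealPoint d x ↔ Submodule.map (rotMap (-1)) x = x) := by
  intro x _ hx
  have key := Wrk.twisted_closed h hne him x hx
  constructor
  · rintro ⟨f, _, hspan, hf⟩
    have hle : Submodule.map (rotMap (-1)) x ≤ x := by
      conv_lhs => rw [← hspan]
      rw [Submodule.map_span_le]
      rintro _ ⟨i, rfl⟩
      have h1 := key (f i) (hspan.le (Submodule.subset_span ⟨i, rfl⟩))
      have h2 : (f i).map (starRingEnd ℂ) = f i := by
        ext1 k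
        rw [coeff_map]
        exact Complex.conj_eq_iff_im.mpr (hf i k)
      rwa [h2] at h1
    refine le_antisymm hle fun p hp => ⟨rotMap (-1) p, hle ⟨p, hp, rfl⟩, ?_⟩
    rw [Wrk.rotMap_rotMap]
    simp [Wrk.rotMap_one]
  · intro hfix
    have hcl : ∀ p ∈ x, p.map (starRingEnd ℂ) ∈ x := by
      intro p hp
      rw [← hfix]
      refine ⟨_, key p hp, ?_⟩
      rw [Wrk.rotMap_rotMap]
      simp [Wrk.rotMap_one]
    obtain ⟨f, c, hc, hli, hspan, hw⟩ := hx
    obtain ⟨a, g, _, _, _, h3, h4, h5⟩ := Wrk.exists_reduced_basis f hli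
    rw [hspan] at h5
    refine ⟨g, h4, h5, fun i k => ?_⟩
    have h6 := Wrk.fixed_of_reduced (starRingEnd ℂ) g a h3 i (by
      rw [h5]
      exact hcl _ (h5.le (Submodule.subset_span ⟨i, rfl⟩)))
    have h7 := congrArg (fun p => coeff p k) h6
    simp only [coeff_map] at h7
    exact Complex.conj_eq_iff_im.mp h7
end
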